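/- Let H₁, H₂ be separable Hilbert spaces each of dimension at least 3, and let m : P(H₁) × P(H₂) → ℝ≥0 be a positive quantum bi-measure (orthoadditive in each variable separately, completely additive). Then for every pair of positive operators x₁ ∈ B(H₁), the map y ↦ M(x₁, y) is a positive normal (weak-* continuous) functional on B(H₂), where M is the bounded bilinear extension of m. -/

import Mathlib

open scoped InnerProductSpace

/-- orthogonal projection (self-adjoint idempotent). -/
def IsProjectionOp {H : Type*} [NormedAddCommGroup H] [InnerProductSpace ℂ H]
    [CompleteSpace H] (e : H →L[ℂ] H) : Prop :=
  IsIdempotentElem e ∧ IsSelfAdjoint e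

variable {H₁ H₂ : Type*}
  [NormedAddCommGroup H₁] [InnerProductSpace ℂ H₁] [CompleteSpace H₁]
  [NormedAddCommGroup H₂] [InnerProductSpace ℂ H₂] [CompleteSpace H₂]

/-- A positive, completely additive quantum bi-measure on
`P(H₁) × P(H₂)`: nonnegative on pairs of projections and completely
orthoadditive in each variable separately (sums of orthogonal projections
taken in the strong operator topology). -/
def IsQuantumBimeasure (m : (H₁ →L[ℂ] H₁) → (H₂ →L[ℂ] H₂) → ℝ) : Prop :=
  (∀ e₁ e₂, IsProjectionOp e₁ → IsProjectionOp e₂ → 0 ≤ m e₁ e₂) ∧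
  (∀ (ι : Type) (p : ι → (H₁ →L[ℂ] H₁)) (q : H₁ →L[ℂ] H₁) (e₂ : H₂ →L[ℂ] H₂),
    IsProjectionOp e₂ → (∀ i, IsProjectionOp (p i)) → IsProjectionOp q →
    (∀ i j, i ≠ j → p i * p j = 0) →
    (∀ v : H₁, HasSum (fun i => p i v) (q v)) →
    HasSum (fun i => m (p i) e₂) (m q e₂)) ∧
  (∀ (ι : Type) (p : ι → (H₂ →L[ℂ] H₂)) (q : H₂ →L[ℂ] H₂) (e₁ : H₁ →L[ℂ] H₁),
    IsProjectionOp e₁ → (∀ i, IsProjectionOp (p i)) → IsProjectionOp q →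
    (∀ i j, i ≠ j → p i * p j = 0) →
    (∀ v : H₂, HasSum (fun i => p i v) (q v)) →
    HasSum (fun i => m e₁ (p i)) (m e₁ q))

/-- An additive function on `[0, 1]` that is bounded and vanishes at `1` is zero. -/
theorem eq_zero_of_bounded_additive {d : ℝ → ℝ} {C : ℝ}
    (hC : ∀ t, 0 ≤ t → t ≤ 1 → |d t| ≤ C) (h1 : d 1 = 0)
    (hadd : ∀ s t, 0 ≤ s → 0 ≤ t → s + t ≤ 1 → d (s + t) = d s + d t)
    {t : ℝ} (ht0 : 0 ≤ t) (ht1 : t ≤ 1) : d t = 0 := by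
  have halve : ∀ S, (∀ t, 0 ≤ t → t ≤ 1 → |d t| ≤ S) →
      ∀ t, 0 ≤ t → t ≤ 1 → |d t| ≤ S / 2 := by
    intro S hS
    have hsmall : ∀ t, 0 ≤ t → t ≤ 1 / 2 → |d t| ≤ S / 2 := by
      intro t h0 h2
      have h := hadd t t h0 h0 (by linarith)
      have hb := hS (t + t) (by linarith) (by linarith)
      rw [h, ← two_mul, abs_mul, abs_two] at hb
      linarith
    intro t h0 h1'
    rcases le_total t (1 / 2) with h | h
    · exact hsmall t h0 h
    · have h2 := hadd t (1 - t) h0 (by linarith) (by linarith)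
      rw [add_sub_cancel, h1] at h2
      rw [show d t = -d (1 - t) by linarith, abs_neg]
      exact hsmall _ (by linarith) (by linarith)
  have iter : ∀ n : ℕ, ∀ t, 0 ≤ t → t ≤ 1 → |d t| ≤ C * (1 / 2) ^ n := by
    intro n
    induction n with
    | zero => simpa using hC
    | succ n ih =>
      intro t h0 h1'
      have := halve _ ih t h0 h1'
      rw [pow_succ]
      linarith
  have hlim : Filter.Tendsto (fun n : ℕ => C * (1 / 2 : ℝ) ^ n) Filter.atTop (nhds (C * 0)) :=
    (tendsto_pow_atTop_nhds_zero_of_lt_one (by norm_num) (by norm_num)).const_mul C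
  rw [mul_zero] at hlim
  exact abs_nonpos_iff.mp (ge_of_tendsto' hlim fun n => iter n t ht0 ht1)

/-- A function on the nonzero vectors of `ℝ³`, constant on punctured lines, whose values on
every orthogonal triple add up to `w`. -/
structure IsFrameFunction (f : EuclideanSpace ℝ (Fin 3) → ℝ) (w : ℝ) : Prop where
  smul : ∀ t : ℝ, t ≠ 0 → ∀ x, f (t • x) = f x
  sum_eq : ∀ x y z, x ≠ 0 → y ≠ 0 → z ≠ 0 → ⟪x, y⟫_ℝ = 0 → ⟪x, z⟫_ℝ = 0 → ⟪y, z⟫_ℝ = 0 →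
    f x + f y + f z = w

theorem inner_vec3 (a b c a' b' c' : ℝ) :
    ⟪(!₂[a, b, c] : EuclideanSpace ℝ (Fin 3)), !₂[a', b', c']⟫_ℝ = a * a' + b * b' + c * c' := by
  simp [PiLp.inner_apply, Fin.sum_univ_three]
  ring

theorem vec3_ne_zero {a b c : ℝ} (h : a ^ 2 + b ^ 2 + c ^ 2 ≠ 0) :
    (!₂[a, b, c] : EuclideanSpace ℝ (Fin 3)) ≠ 0 := by
  intro h0
  apply h
  have := inner_vec3 a b c a b c
  rw [h0, inner_zero_left] at this
  linarith

theorem IsFrameFunction.sum_vec3 {f : EuclideanSpace ℝ (Fin 3) → ℝ} {w : ℝ}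
    (hf : IsFrameFunction f w) {a₁ b₁ c₁ a₂ b₂ c₂ a₃ b₃ c₃ : ℝ}
    (h₁ : a₁ ^ 2 + b₁ ^ 2 + c₁ ^ 2 ≠ 0) (h₂ : a₂ ^ 2 + b₂ ^ 2 + c₂ ^ 2 ≠ 0)
    (h₃ : a₃ ^ 2 + b₃ ^ 2 + c₃ ^ 2 ≠ 0) (h₁₂ : a₁ * a₂ + b₁ * b₂ + c₁ * c₂ = 0)
    (h₁₃ : a₁ * a₃ + b₁ * b₃ + c₁ * c₃ = 0) (h₂₃ : a₂ * a₃ + b₂ * b₃ + c₂ * c₃ = 0) :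
    f !₂[a₁, b₁, c₁] + f !₂[a₂, b₂, c₂] + f !₂[a₃, b₃, c₃] = w :=
  hf.sum_eq _ _ _ (vec3_ne_zero h₁) (vec3_ne_zero h₂) (vec3_ne_zero h₃)
    ((inner_vec3 ..).trans h₁₂) ((inner_vec3 ..).trans h₁₃) ((inner_vec3 ..).trans h₂₃)

section Polar

variable {g : EuclideanSpace ℝ (Fin 3) → ℝ} {k δ : ℝ}

/-- The values of a nonnegative frame function that is constant on the equator are bounded by
the sum of its values at the equator and at the pole. -/
theorem IsFrameFunction.le_of_equator (hg : IsFrameFunction g (2 * k + 2 * δ))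
    (h0 : ∀ x, 0 ≤ g x) (hk : ∀ a b : ℝ, a ^ 2 + b ^ 2 ≠ 0 → g !₂[a, b, 0] = k)
    {a b : ℝ} (c : ℝ) (hab : a ^ 2 + b ^ 2 ≠ 0) : g !₂[a, b, c] ≤ k + 2 * δ := by
  have hpos : 0 < a ^ 2 + b ^ 2 := lt_of_le_of_ne (by positivity) (Ne.symm hab)
  have h := hg.sum_vec3 (a₁ := a) (b₁ := b) (c₁ := c) (a₂ := a * c) (b₂ := b * c)
    (c₂ := -(a ^ 2 + b ^ 2)) (a₃ := -b) (b₃ := a) (c₃ := 0) (by positivity)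
    (by
      have : 0 < (-(a ^ 2 + b ^ 2)) ^ 2 := by rw [neg_sq]; positivity
      positivity)
    (by nlinarith) (by ring) (by ring) (by ring)
  have h2 := hk (-b) a (by nlinarith)
  have := h0 !₂[a * c, b * c, -(a ^ 2 + b ^ 2)]
  linarith

theorem IsFrameFunction.le_add_of_descent (hg : IsFrameFunction g (2 * k + 2 * δ))
    (h0 : ∀ x, 0 ≤ g x) (hk : ∀ a b : ℝ, a ^ 2 + b ^ 2 ≠ 0 → g !₂[a, b, 0] = k)
    {a b : ℝ} (hab : a ^ 2 + b ^ 2 ≠ 0) (t : ℝ) :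
    g !₂[a, b, 1] ≤ g !₂[a - t * b, b + t * a, 1] + 2 * δ := by
  have hpos : 0 < a ^ 2 + b ^ 2 := lt_of_le_of_ne (by positivity) (Ne.symm hab)
  set r := a ^ 2 + b ^ 2 with hr
  have hn : (-a) ^ 2 + (-b) ^ 2 + r ^ 2 ≠ 0 := by
    have : (-a) ^ 2 + (-b) ^ 2 + r ^ 2 = r + r ^ 2 := by rw [hr]; ring
    rw [this]; positivity
  have h := hg.sum_vec3 (a₁ := a) (b₁ := b) (c₁ := 1) (a₂ := -b) (b₂ := a)
    (c₂ := 0) (a₃ := -a) (b₃ := -b) (c₃ := r) (by positivity)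
    (by nlinarith) hn (by ring) (by rw [hr]; ring) (by ring)
  have hperp : ((1 + r) * -b - t * r * a) ^ 2 + ((1 + r) * a - t * r * b) ^ 2 ≠ 0 := by
    have : ((1 + r) * -b - t * r * a) ^ 2 + ((1 + r) * a - t * r * b) ^ 2
        = r * ((1 + r) ^ 2 + (t * r) ^ 2) := by rw [hr]; ring
    rw [this]; positivity
  have h' := hg.sum_vec3 (a₁ := a - t * b) (b₁ := b + t * a) (c₁ := 1)
    (a₂ := (1 + r) * -b - t * r * a) (b₂ := (1 + r) * a - t * r * b)
    (c₂ := -(t * r)) (a₃ := -a) (b₃ := -b) (c₃ := r) (by positivity)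
    (by
      have : 0 < ((1 + r) * -b - t * r * a) ^ 2 + ((1 + r) * a - t * r * b) ^ 2 :=
        lt_of_le_of_ne (by positivity) (Ne.symm hperp)
      positivity)
    hn (by rw [hr]; ring) (by rw [hr]; ring) (by rw [hr]; ring)
  have h2 := hk (-b) a (by nlinarith)
  have := hg.le_of_equator h0 hk (-(t * r)) hperp
  linarith

/-- In the gnomonic chart around the pole, a frame function increases, up to `4 * δ`, when
passing from a point of the disc with diameter `[0, (a', b')]` to `(a', b')`. -/
theorem IsFrameFunction.le_add_of_mem_disc (hg : IsFrameFunction g (2 * k + 2 * δ))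
    (h0 : ∀ x, 0 ≤ g x) (hk : ∀ a b : ℝ, a ^ 2 + b ^ 2 ≠ 0 → g !₂[a, b, 0] = k)
    {a b a' b' : ℝ} (hab : a ^ 2 + b ^ 2 ≠ 0) (h : a ^ 2 + b ^ 2 ≤ a * a' + b * b') :
    g !₂[a, b, 1] ≤ g !₂[a', b', 1] + 4 * δ := by
  have hpos : 0 < a ^ 2 + b ^ 2 := lt_of_le_of_ne (by positivity) (Ne.symm hab)
  set r := a ^ 2 + b ^ 2 with hr
  set X := (a * a' + b * b') / r with hX
  set Y := (a * b' - b * a') / r with hY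
  have hX1 : 1 ≤ X := by rw [hX, le_div_iff₀ hpos]; linarith
  have hXr : X * r = a * a' + b * b' := by rw [hX]; field_simp
  have hYr : Y * r = a * b' - b * a' := by rw [hY]; field_simp
  obtain ⟨t, ht⟩ : ∃ t, t * (Y - t) = 1 - X := by
    refine ⟨(Y + √(Y ^ 2 - 4 * (1 - X))) / 2, ?_⟩
    have := Real.sq_sqrt (show 0 ≤ Y ^ 2 - 4 * (1 - X) by nlinarith [sq_nonneg Y])
    linear_combination (-1 / 4) * this
  have s1 := hg.le_add_of_descent h0 hk hab t
  have hab' : (a - t * b) ^ 2 + (b + t * a) ^ 2 ≠ 0 := by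
    have : (a - t * b) ^ 2 + (b + t * a) ^ 2 = r * (1 + t ^ 2) := by rw [hr]; ring
    rw [this]; positivity
  have s2 := hg.le_add_of_descent h0 hk hab' (Y - t)
  have e1 : a - t * b - (Y - t) * (b + t * a) = a' := by
    have : (a - t * b - (Y - t) * (b + t * a)) * r = a' * r := by
      linear_combination (-a * r) * ht - b * hYr + a * hXr - a' * hr
    exact mul_right_cancel₀ hpos.ne' this
  have e2 : b + t * a + (Y - t) * (a - t * b) = b' := by
    have : (b + t * a + (Y - t) * (a - t * b)) * r = b' * r := by
      linear_combination (-b * r) * ht + a * hYr + b * hXr - b' * hr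
    exact mul_right_cancel₀ hpos.ne' this
  rw [e1, e2] at s2
  linarith

theorem IsFrameFunction.exists_half (hg : IsFrameFunction g (2 * k + 2 * δ))
    (hk : ∀ a b : ℝ, a ^ 2 + b ^ 2 ≠ 0 → g !₂[a, b, 0] = k)
    {a b : ℝ} (hab : a ^ 2 + b ^ 2 ≠ 0) :
    ∃ a' b' : ℝ, a' ^ 2 + b' ^ 2 ≠ 0 ∧ g !₂[a', b', 1] ≤ g !₂[a, b, 1] / 2 + δ := by
  have hpos : 0 < a ^ 2 + b ^ 2 := lt_of_le_of_ne (by positivity) (Ne.symm hab)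
  set r := a ^ 2 + b ^ 2 with hr
  obtain ⟨N, hN⟩ : ∃ N : ℝ, N ^ 2 = 1 + r := ⟨√(1 + r), Real.sq_sqrt (by positivity)⟩
  have key : ∀ s : ℝ, s ^ 2 = 1 + r →
      ((a + s * b) / (1 + s ^ 2)) ^ 2 + ((b - s * a) / (1 + s ^ 2)) ^ 2 ≠ 0 ∧
      g !₂[-(a + s * b), -(b - s * a), r] +
        g !₂[(a + s * b) / (1 + s ^ 2), (b - s * a) / (1 + s ^ 2), 1] = k + 2 * δ ∧
      (-(a + s * b)) ^ 2 + (-(b - s * a)) ^ 2 + r ^ 2 ≠ 0 := by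
    intro s hs
    have hs1 : 0 < 1 + s ^ 2 := by positivity
    have hsq : (a + s * b) ^ 2 + (b - s * a) ^ 2 = r * (1 + s ^ 2) := by rw [hr]; ring
    have hsqpos : 0 < (a + s * b) ^ 2 + (b - s * a) ^ 2 := by rw [hsq]; positivity
    have hsq' : ((a + s * b) / (1 + s ^ 2)) ^ 2 + ((b - s * a) / (1 + s ^ 2)) ^ 2
        = r / (1 + s ^ 2) := by
      rw [div_pow, div_pow, ← add_div, hsq]; field_simp
    have hne : (-(a + s * b)) ^ 2 + (-(b - s * a)) ^ 2 + r ^ 2 ≠ 0 := by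
      rw [neg_sq, neg_sq]; positivity
    refine ⟨by rw [hsq']; positivity, ?_, hne⟩
    have h := hg.sum_vec3 (a₁ := -(a + s * b)) (b₁ := -(b - s * a)) (c₁ := r)
      (a₂ := (a + s * b) / (1 + s ^ 2)) (b₂ := (b - s * a) / (1 + s ^ 2)) (c₂ := 1)
      (a₃ := -(b - s * a)) (b₃ := a + s * b) (c₃ := 0) hne (by rw [hsq']; positivity)
      (by nlinarith) (by field_simp; linear_combination -hsq) (by ring) (by ring)
    have := hk (-(b - s * a)) (a + s * b) (by nlinarith)
    linarith
  obtain ⟨p1, q1, n1⟩ := key N hN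
  obtain ⟨p2, q2, n2⟩ := key (-N) (by rw [neg_sq, hN])
  have h := hg.sum_vec3 (a₁ := a) (b₁ := b) (c₁ := 1) (by positivity) n1 n2
    (by rw [hr]; ring) (by rw [hr]; ring) (by linear_combination (-r) * hN + (N ^ 2 - 1) * hr)
  by_cases hc : g !₂[(a + N * b) / (1 + N ^ 2), (b - N * a) / (1 + N ^ 2), 1]
      ≤ g !₂[a, b, 1] / 2 + δ
  · exact ⟨_, _, p1, hc⟩
  · exact ⟨_, _, p2, by linarith⟩

theorem IsFrameFunction.exists_le_of_equator (hg : IsFrameFunction g (2 * k + 2 * δ))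
    (h0 : ∀ x, 0 ≤ g x) (hk : ∀ a b : ℝ, a ^ 2 + b ^ 2 ≠ 0 → g !₂[a, b, 0] = k)
    {κ : ℝ} (hκ : 2 * δ < κ) :
    ∃ a b : ℝ, a ^ 2 + b ^ 2 ≠ 0 ∧ g !₂[a, b, 1] ≤ κ := by
  have iter : ∀ n : ℕ, ∃ a b : ℝ, a ^ 2 + b ^ 2 ≠ 0 ∧
      g !₂[a, b, 1] ≤ k * (1 / 2) ^ n + 2 * δ := by
    intro n
    induction n with
    | zero => exact ⟨1, 0, by norm_num, by simpa using hg.le_of_equator h0 hk 1 (by norm_num)⟩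
    | succ n ih =>
      obtain ⟨a, b, hab, h⟩ := ih
      obtain ⟨a', b', hab', h'⟩ := hg.exists_half hk hab
      exact ⟨a', b', hab', by rw [pow_succ]; linarith⟩
  have hlim : Filter.Tendsto (fun n : ℕ => k * (1 / 2 : ℝ) ^ n + 2 * δ) Filter.atTop
      (nhds (k * 0 + 2 * δ)) :=
    ((tendsto_pow_atTop_nhds_zero_of_lt_one (by norm_num) (by norm_num)).const_mul k).add_const _
  rw [mul_zero, zero_add] at hlim
  obtain ⟨n, hn⟩ := (hlim.eventually_lt_const hκ).exists
  obtain ⟨a, b, hab, h⟩ := iter n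
  exact ⟨a, b, hab, h.trans hn.le⟩

end Polar

theorem IsFrameFunction.comp {f : EuclideanSpace ℝ (Fin 3) → ℝ} {w : ℝ}
    (hf : IsFrameFunction f w)
    (R : EuclideanSpace ℝ (Fin 3) →ₗᵢ[ℝ] EuclideanSpace ℝ (Fin 3)) :
    IsFrameFunction (fun x => f (R x)) w where
  smul t ht x := by rw [map_smul, hf.smul t ht]
  sum_eq x y z hx hy hz hxy hxz hyz :=
    hf.sum_eq _ _ _ ((map_ne_zero_iff R R.injective).mpr hx) ((map_ne_zero_iff R R.injective).mpr hy) ((map_ne_zero_iff R R.injective).mpr hz)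
      (by simpa using hxy) (by simpa using hxz) (by simpa using hyz)

theorem IsFrameFunction.add {f g : EuclideanSpace ℝ (Fin 3) → ℝ} {v w : ℝ}
    (hf : IsFrameFunction f v) (hg : IsFrameFunction g w) :
    IsFrameFunction (fun x => f x + g x) (v + w) where
  smul t ht x := by rw [hf.smul t ht, hg.smul t ht]
  sum_eq x y z hx hy hz hxy hxz hyz := by
    linarith [hf.sum_eq x y z hx hy hz hxy hxz hyz, hg.sum_eq x y z hx hy hz hxy hxz hyz]

theorem IsFrameFunction.sub_const {f : EuclideanSpace ℝ (Fin 3) → ℝ} {w : ℝ}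
    (hf : IsFrameFunction f w) (c : ℝ) : IsFrameFunction (fun x => f x - c) (w - 3 * c) where
  smul t ht x := by rw [hf.smul t ht]
  sum_eq x y z hx hy hz hxy hxz hyz := by
    linarith [hf.sum_eq x y z hx hy hz hxy hxz hyz]

/-- The rotation of `ℝ³` by the angle `θ` around the third axis. -/
noncomputable def rotThird (θ : ℝ) :
    EuclideanSpace ℝ (Fin 3) →ₗᵢ[ℝ] EuclideanSpace ℝ (Fin 3) where
  toFun x := !₂[Real.cos θ * x 0 - Real.sin θ * x 1, Real.sin θ * x 0 + Real.cos θ * x 1, x 2]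
  map_add' x y := by
    ext i; fin_cases i <;> simp <;> ring
  map_smul' t x := by
    ext i; fin_cases i <;> simp <;> ring
  norm_map' x := by
    rw [← sq_eq_sq₀ (norm_nonneg _) (norm_nonneg _)]
    simp only [EuclideanSpace.norm_sq_eq, Fin.sum_univ_three, Real.norm_eq_abs, sq_abs]
    simp
    linear_combination ((x 0) ^ 2 + (x 1) ^ 2) * Real.sin_sq_add_cos_sq θ

theorem rotThird_apply (θ : ℝ) (x : EuclideanSpace ℝ (Fin 3)) :
    rotThird θ x = !₂[Real.cos θ * x 0 - Real.sin θ * x 1,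
      Real.sin θ * x 0 + Real.cos θ * x 1, x 2] := rfl

theorem eq_vec3 (x : EuclideanSpace ℝ (Fin 3)) : x = !₂[x 0, x 1, x 2] := by
  ext i; fin_cases i <;> rfl

theorem exists_isometry_pole {p : EuclideanSpace ℝ (Fin 3)} (hp : ‖p‖ = 1) :
    ∃ R : EuclideanSpace ℝ (Fin 3) ≃ₗᵢ[ℝ] EuclideanSpace ℝ (Fin 3), R !₂[0, 0, 1] = p := by
  have ho : Orthonormal ℝ (({2} : Set (Fin 3)).domRestrict (fun _ : Fin 3 => p)) := by
    refine ⟨fun i => hp, fun i j hij => (hij (Subsingleton.elim i j)).elim⟩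
  obtain ⟨b, hb⟩ := ho.exists_orthonormalBasis_extension_of_card_eq (by simp)
  refine ⟨b.repr.symm, ?_⟩
  have : (!₂[0, 0, 1] : EuclideanSpace ℝ (Fin 3)) = EuclideanSpace.single 2 1 := by
    ext i; fin_cases i <;> simp
  rw [this, b.repr_symm_single, hb 2 rfl]

theorem exists_ne_zero_inner_eq_zero (x y : EuclideanSpace ℝ (Fin 3)) :
    ∃ z, z ≠ 0 ∧ ⟪x, z⟫_ℝ = 0 ∧ ⟪y, z⟫_ℝ = 0 := by
  set S := Submodule.span ℝ ({x, y} : Set (EuclideanSpace ℝ (Fin 3)))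
  have hS : Module.finrank ℝ S ≤ 2 := by
    classical
    have := finrank_span_finset_le_card (R := ℝ) ({x, y} : Finset (EuclideanSpace ℝ (Fin 3)))
    have h2 : ({x, y} : Finset (EuclideanSpace ℝ (Fin 3))).card ≤ 2 := Finset.card_le_two
    simp only [Finset.coe_insert, Finset.coe_singleton] at this
    exact this.trans h2
  have h := S.finrank_add_finrank_orthogonal
  rw [finrank_euclideanSpace_fin] at h
  have hne : Sᗮ ≠ ⊥ := by
    intro hb
    rw [hb, finrank_bot] at h
    omega
  obtain ⟨z, hz, hz0⟩ := Submodule.exists_mem_ne_zero_of_ne_bot hne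
  exact ⟨z, hz0, hz x (Submodule.subset_span (by simp)), hz y (Submodule.subset_span (by simp))⟩

theorem IsFrameFunction.eventually_small_of_pole {f : EuclideanSpace ℝ (Fin 3) → ℝ} {w δ : ℝ}
    (hf : IsFrameFunction f w) (h0 : ∀ x, 0 ≤ f x) (hδ : f !₂[0, 0, 1] < δ) :
    ∃ x, x ≠ 0 ∧ ∀ᶠ y in nhds x, f y ≤ 6 * δ := by
  set d := f !₂[0, 0, 1] with hd
  set g : EuclideanSpace ℝ (Fin 3) → ℝ := fun x => f x + f (rotThird (Real.pi / 2) x) with hgdef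
  have hg : IsFrameFunction g (2 * (w - d) + 2 * d) := by
    have := hf.add (hf.comp (rotThird (Real.pi / 2)))
    rwa [show w + w = 2 * (w - d) + 2 * d by ring] at this
  have hg0 : ∀ x, 0 ≤ g x := fun x => add_nonneg (h0 _) (h0 _)
  have hk : ∀ a b : ℝ, a ^ 2 + b ^ 2 ≠ 0 → g !₂[a, b, 0] = w - d := by
    intro a b hab
    have h := hf.sum_vec3 (a₁ := a) (b₁ := b) (c₁ := 0) (a₂ := -b) (b₂ := a) (c₂ := 0)
      (a₃ := 0) (b₃ := 0) (c₃ := 1) (by simpa using hab)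
      (by rw [neg_sq, add_comm (b ^ 2)]; simpa using hab) (by norm_num) (by ring) (by ring)
      (by ring)
    have e : rotThird (Real.pi / 2) !₂[a, b, 0] = !₂[-b, a, 0] := by
      rw [rotThird_apply]; simp
    simp only [hgdef, e]
    linarith
  obtain ⟨a, b, hab, hle⟩ := hg.exists_le_of_equator hg0 hk (κ := 2 * δ) (by linarith)
  have hpos : 0 < a ^ 2 + b ^ 2 := lt_of_le_of_ne (by positivity) (Ne.symm hab)
  refine ⟨!₂[a / 2, b / 2, 1], vec3_ne_zero (by positivity), ?_⟩
  have hopen : IsOpen {y : EuclideanSpace ℝ (Fin 3) |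
      y 0 ^ 2 + y 1 ^ 2 < y 2 * (y 0 * a + y 1 * b)} :=
    isOpen_lt (by fun_prop) (by fun_prop)
  filter_upwards [hopen.mem_nhds (show _ from by simp; nlinarith)] with y hy
  change y 0 ^ 2 + y 1 ^ 2 < y 2 * (y 0 * a + y 1 * b) at hy
  have hy2 : y 2 ≠ 0 := by
    intro h
    rw [h, zero_mul] at hy
    nlinarith [sq_nonneg (y 0), sq_nonneg (y 1)]
  have hy2' : 0 < y 2 ^ 2 := by positivity
  have hne : (y 0 / y 2) ^ 2 + (y 1 / y 2) ^ 2 ≠ 0 := by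
    intro h
    have h1 : y 0 / y 2 = 0 := by nlinarith [sq_nonneg (y 0 / y 2), sq_nonneg (y 1 / y 2)]
    have h2 : y 1 / y 2 = 0 := by nlinarith [sq_nonneg (y 0 / y 2), sq_nonneg (y 1 / y 2)]
    rw [div_eq_zero_iff, or_iff_left hy2] at h1 h2
    rw [h1, h2] at hy
    simp at hy
  have hdisc : (y 0 / y 2) ^ 2 + (y 1 / y 2) ^ 2 ≤ y 0 / y 2 * a + y 1 / y 2 * b := by
    rw [div_pow, div_pow, ← add_div, div_le_iff₀ hy2']
    have : (y 0 / y 2 * a + y 1 / y 2 * b) * y 2 ^ 2 = y 2 * (y 0 * a + y 1 * b) := by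
      field_simp
    rw [this]
    exact hy.le
  have h1 := hg.le_add_of_mem_disc hg0 hk hne hdisc
  have e : f y = f !₂[y 0 / y 2, y 1 / y 2, 1] := by
    rw [← hf.smul (y 2) hy2 !₂[y 0 / y 2, y 1 / y 2, 1]]
    congr 1
    conv_lhs => rw [eq_vec3 y]
    ext i; fin_cases i <;> simp <;> field_simp
  have h2 := h0 (rotThird (Real.pi / 2) !₂[y 0 / y 2, y 1 / y 2, 1])
  simp only [hgdef] at h1 hle
  rw [e]
  linarith

theorem IsFrameFunction.exists_eventually_small {f : EuclideanSpace ℝ (Fin 3) → ℝ} {w : ℝ}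
    (hf : IsFrameFunction f w) (h0 : ∀ x, 0 ≤ f x) (hinf : ∀ ε > 0, ∃ x, x ≠ 0 ∧ f x < ε)
    {η : ℝ} (hη : 0 < η) : ∃ x, x ≠ 0 ∧ ∀ᶠ y in nhds x, f y ≤ η := by
  obtain ⟨p, hp, hfp⟩ := hinf (η / 6) (by positivity)
  obtain ⟨R, hR⟩ := exists_isometry_pole (p := (‖p‖⁻¹ : ℝ) • p) (norm_smul_inv_norm hp)
  have hpole : f (R.toLinearIsometry !₂[0, 0, 1]) < η / 6 := by
    rw [LinearIsometryEquiv.coe_toLinearIsometry, hR, hf.smul _ (by simpa using hp)]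
    exact hfp
  obtain ⟨x, hx, h⟩ := (hf.comp R.toLinearIsometry).eventually_small_of_pole (fun x => h0 _) hpole
  refine ⟨R x, by simpa using hx, ?_⟩
  have hc : Filter.Tendsto R.symm (nhds (R x)) (nhds x) := by
    have := R.symm.continuous.tendsto (R x)
    rwa [R.symm_apply_apply] at this
  filter_upwards [hc.eventually h] with y hy
  simpa [mul_div_cancel₀] using hy

/-- Two orthogonal pairs in the same plane have the same sum of values. -/
theorem IsFrameFunction.add_eq_add {f : EuclideanSpace ℝ (Fin 3) → ℝ} {w : ℝ}
    (hf : IsFrameFunction f w) {x z : EuclideanSpace ℝ (Fin 3)} (hx : x ≠ 0) (hz : z ≠ 0)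
    {α β : ℝ} (hx' : z - α • x ≠ 0) (hz' : x - β • z ≠ 0)
    (hxo : ⟪x, z - α • x⟫_ℝ = 0) (hzo : ⟪z, x - β • z⟫_ℝ = 0) :
    f x + f (z - α • x) = f z + f (x - β • z) := by
  obtain ⟨n, hn, hxn, hzn⟩ := exists_ne_zero_inner_eq_zero x z
  have h1 := hf.sum_eq x (z - α • x) n hx hx' hn hxo hxn
    (by rw [inner_sub_left, inner_smul_left, hxn, hzn]; simp)
  have h2 := hf.sum_eq z (x - β • z) n hz hz' hn hzo hzn
    (by rw [inner_sub_left, inner_smul_left, hxn, hzn]; simp)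
  linarith

/-- Control of the oscillation at a point propagates to all orthogonal points. -/
theorem IsFrameFunction.eventually_osc_orthogonal {f : EuclideanSpace ℝ (Fin 3) → ℝ} {w η : ℝ}
    (hf : IsFrameFunction f w) {p x₀ : EuclideanSpace ℝ (Fin 3)} (hp : p ≠ 0) (hx₀ : x₀ ≠ 0)
    (hpx : ⟪x₀, p⟫_ℝ = 0) (h : ∀ᶠ y in nhds p, |f y - f p| ≤ η) :
    ∀ᶠ y in nhds x₀, |f y - f x₀| ≤ 4 * η := by
  have hU : ∀ᶠ y in nhds p, y ≠ 0 ∧ |f y - f p| ≤ η := (isOpen_ne.mem_nhds hp |> fun h' => by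
    filter_upwards [h', h] with y h1 h2 using ⟨h1, h2⟩)
  have move : ∀ x z : EuclideanSpace ℝ (Fin 3), x ≠ 0 → z ≠ 0 → ∀ s : ℝ, s ≠ 0 →
      (s • (z - (⟪x, z⟫_ℝ / ⟪x, x⟫_ℝ) • x) ≠ 0 ∧
        |f (s • (z - (⟪x, z⟫_ℝ / ⟪x, x⟫_ℝ) • x)) - f p| ≤ η) →
      ((-s) • (x - (⟪x, z⟫_ℝ / ⟪z, z⟫_ℝ) • z) ≠ 0 ∧
        |f ((-s) • (x - (⟪x, z⟫_ℝ / ⟪z, z⟫_ℝ) • z)) - f p| ≤ η) →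
      |f x - f z| ≤ 2 * η := by
    rintro x z hx hz s hs ⟨ha, ha'⟩ ⟨hb, hb'⟩
    rw [hf.smul s hs] at ha'
    rw [hf.smul (-s) (neg_ne_zero.mpr hs)] at hb'
    have hxx : ⟪x, x⟫_ℝ ≠ 0 := by simpa using hx
    have hzz : ⟪z, z⟫_ℝ ≠ 0 := by simpa using hz
    have := hf.add_eq_add hx hz (smul_ne_zero_iff.mp ha).2 (smul_ne_zero_iff.mp hb).2
      (by rw [inner_sub_right, inner_smul_right, div_mul_cancel₀ _ hxx, sub_self])
      (by rw [inner_sub_right, inner_smul_right, div_mul_cancel₀ _ hzz, real_inner_comm, sub_self])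
    rw [abs_le] at *
    constructor <;> linarith [ha'.1, ha'.2, hb'.1, hb'.2]
  have hxx : ⟪x₀, x₀⟫_ℝ ≠ 0 := by simpa using hx₀
  have hz0 : ∀ ζ : ℝ, x₀ + ζ • p ≠ 0 := by
    intro ζ hz
    have : ⟪x₀, x₀ + ζ • p⟫_ℝ = ⟪x₀, x₀⟫_ℝ := by
      rw [inner_add_right, inner_smul_right, hpx]; ring
    rw [hz, inner_zero_right] at this
    exact hxx this.symm
  have hzz : ∀ ζ : ℝ, ⟪x₀ + ζ • p, x₀ + ζ • p⟫_ℝ ≠ 0 := fun ζ => by simpa using hz0 ζ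
  have hxz : ∀ ζ : ℝ, ⟪x₀, x₀ + ζ • p⟫_ℝ = ⟪x₀, x₀⟫_ℝ := by
    intro ζ
    rw [inner_add_right, inner_smul_right, hpx]; ring
  -- the component of `-x₀` orthogonal to `x₀ + ζ • p`, rescaled
  have hzperp : ∀ ζ : ℝ, ζ ≠ 0 →
      (-ζ⁻¹) • (x₀ - (⟪x₀, x₀ + ζ • p⟫_ℝ / ⟪x₀ + ζ • p, x₀ + ζ • p⟫_ℝ) • (x₀ + ζ • p)) =
      (⟪x₀, x₀⟫_ℝ / ⟪x₀ + ζ • p, x₀ + ζ • p⟫_ℝ) • p -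
        (ζ * ⟪p, p⟫_ℝ / ⟪x₀ + ζ • p, x₀ + ζ • p⟫_ℝ) • x₀ := by
    intro ζ hζ
    have hpx' : ⟪p, x₀⟫_ℝ = 0 := by rw [real_inner_comm]; exact hpx
    have hD : ⟪x₀ + ζ • p, x₀ + ζ • p⟫_ℝ = ⟪x₀, x₀⟫_ℝ + ζ ^ 2 * ⟪p, p⟫_ℝ := by
      simp only [inner_add_left, inner_add_right, inner_smul_left, inner_smul_right, hpx, hpx']
      simp; ring
    have hD0 := hzz ζ
    rw [hxz ζ]
    rw [hD] at hD0 ⊢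
    match_scalars <;> field_simp <;> ring
  have hcont : Filter.Tendsto (fun ζ : ℝ =>
      (⟪x₀, x₀⟫_ℝ / ⟪x₀ + ζ • p, x₀ + ζ • p⟫_ℝ) • p -
        (ζ * ⟪p, p⟫_ℝ / ⟪x₀ + ζ • p, x₀ + ζ • p⟫_ℝ) • x₀) (nhds 0) (nhds p) := by
    have hc : Continuous (fun ζ : ℝ =>
      (⟪x₀, x₀⟫_ℝ / ⟪x₀ + ζ • p, x₀ + ζ • p⟫_ℝ) • p -
        (ζ * ⟪p, p⟫_ℝ / ⟪x₀ + ζ • p, x₀ + ζ • p⟫_ℝ) • x₀) := by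
      refine Continuous.sub (Continuous.smul (Continuous.div ?_ ?_ hzz) ?_)
        (Continuous.smul (Continuous.div ?_ ?_ hzz) ?_) <;> fun_prop
    have := hc.tendsto 0
    simp only [zero_smul, add_zero, zero_mul, zero_div, div_self hxx, one_smul, sub_zero] at this
    exact this
  obtain ⟨ζ, hζU, hζ⟩ : ∃ ζ : ℝ, _ ∧ ζ ≠ 0 := by
    have h1 := (hcont.eventually hU.eventually_nhds).filter_mono (nhdsWithin_le_nhds (s := {0}ᶜ))
    exact (h1.and self_mem_nhdsWithin).exists
  rw [← hzperp ζ hζ] at hζU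
  set z := x₀ + ζ • p with hz
  have hdir : ζ⁻¹ • (z - (⟪x₀, z⟫_ℝ / ⟪x₀, x₀⟫_ℝ) • x₀) = p := by
    rw [hxz ζ, div_self hxx, one_smul, hz, add_sub_cancel_left, smul_smul, inv_mul_cancel₀ hζ,
      one_smul]
  have hbase : |f x₀ - f z| ≤ 2 * η :=
    move x₀ z hx₀ (hz0 ζ) ζ⁻¹ (inv_ne_zero hζ) (by rw [hdir]; exact hU.self_of_nhds)
      hζU.self_of_nhds
  have hc1 : ContinuousAt (fun x => ζ⁻¹ • (z - (⟪x, z⟫_ℝ / ⟪x, x⟫_ℝ) • x)) x₀ := by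
    have : ContinuousAt (fun x => ⟪x, z⟫_ℝ / ⟪x, x⟫_ℝ) x₀ :=
      ContinuousAt.div₀ (by fun_prop) (by fun_prop) hxx
    fun_prop
  have hc2 : ContinuousAt (fun x => (-ζ⁻¹) • (x - (⟪x, z⟫_ℝ / ⟪z, z⟫_ℝ) • z)) x₀ := by
    fun_prop
  have he1 := Filter.Tendsto.eventually hc1 (hdir.symm ▸ hU)
  have he2 := Filter.Tendsto.eventually hc2 hζU
  filter_upwards [he1, he2, isOpen_ne.mem_nhds hx₀] with x h1 h2 h3
  rw [hdir] at h1
  have := move x z h3 (hz0 ζ) ζ⁻¹ (inv_ne_zero hζ) h1 h2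
  rw [abs_le] at *
  constructor <;> linarith [this.1, this.2, hbase.1, hbase.2]

/-- A frame function that is bounded from below is continuous away from the origin. -/
theorem IsFrameFunction.continuousAt {f : EuclideanSpace ℝ (Fin 3) → ℝ} {w : ℝ}
    (hf : IsFrameFunction f w) (h0 : ∀ x, 0 ≤ f x) {x : EuclideanSpace ℝ (Fin 3)} (hx : x ≠ 0) :
    ContinuousAt f x := by
  set S := f '' {0}ᶜ
  have hSne : S.Nonempty := ⟨f x, x, hx, rfl⟩
  have hSbdd : BddBelow S := ⟨0, by rintro _ ⟨y, -, rfl⟩; exact h0 y⟩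
  set c := sInf S with hc
  -- the value at the origin is irrelevant, so it is replaced by the infimum
  set f₁ : EuclideanSpace ℝ (Fin 3) → ℝ := fun y => max (f y) c - c with hf₁
  have hcle : ∀ y, y ≠ 0 → c ≤ f y := fun y hy => csInf_le hSbdd ⟨y, hy, rfl⟩
  have hf₁eq : ∀ y, y ≠ 0 → f₁ y = f y - c := fun y hy => by
    simp only [hf₁, max_eq_left (hcle y hy)]
  have hframe : IsFrameFunction f₁ (w - 3 * c) := by
    refine ⟨fun t ht y => by simp only [hf₁, hf.smul t ht], ?_⟩
    intro x y z hx hy hz hxy hxz hyz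
    rw [hf₁eq x hx, hf₁eq y hy, hf₁eq z hz]
    linarith [hf.sum_eq x y z hx hy hz hxy hxz hyz]
  have hinf : ∀ ε > 0, ∃ y, y ≠ 0 ∧ f₁ y < ε := by
    intro ε hε
    obtain ⟨_, ⟨y, hy, rfl⟩, hlt⟩ := exists_lt_of_csInf_lt hSne (show sInf S < c + ε by linarith)
    exact ⟨y, hy, by rw [hf₁eq y hy]; linarith⟩
  have hnn : ∀ y, 0 ≤ f₁ y := fun y => sub_nonneg.mpr (le_max_right _ _)
  have hosc : ∀ ε > 0, ∀ᶠ y in nhds x, |f₁ y - f₁ x| ≤ ε := by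
    intro ε hε
    obtain ⟨p, hp, hsmall⟩ := hframe.exists_eventually_small hnn hinf (show 0 < ε / 16 by positivity)
    have hp' : ∀ᶠ y in nhds p, |f₁ y - f₁ p| ≤ ε / 16 := by
      filter_upwards [hsmall] with y hy
      rw [abs_le]
      constructor <;> linarith [hnn y, hnn p, hsmall.self_of_nhds]
    obtain ⟨q, hq, hpq, hxq⟩ := exists_ne_zero_inner_eq_zero p x
    have hq' := hframe.eventually_osc_orthogonal hp hq (by rw [real_inner_comm]; exact hpq) hp'
    have hx' := hframe.eventually_osc_orthogonal hq hx hxq hq'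
    filter_upwards [hx'] with y hy
    linarith
  have hcont : ContinuousAt f₁ x := by
    rw [Metric.continuousAt_iff']
    intro ε hε
    filter_upwards [hosc (ε / 2) (by positivity)] with y hy
    rw [Real.dist_eq]
    linarith
  have : f₁ =ᶠ[nhds x] fun y => f y - c := by
    filter_upwards [isOpen_ne.mem_nhds hx] with y hy using hf₁eq y hy
  have h := (hcont.congr this).add_const c
  simpa using h

/-- The homogeneous quadratic extension of a function that is constant on punctured lines. -/
noncomputable def quadExt (f : EuclideanSpace ℝ (Fin 3) → ℝ) (x : EuclideanSpace ℝ (Fin 3)) : ℝ :=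
  ‖x‖ ^ 2 * f x

theorem rotThird_rotThird (θ α : ℝ) (x : EuclideanSpace ℝ (Fin 3)) :
    rotThird θ (rotThird α x) = rotThird (θ + α) x := by
  simp only [rotThird_apply, Real.cos_add, Real.sin_add]
  ext i; fin_cases i <;> simp <;> ring

theorem rotThird_two_pi_add (θ : ℝ) (x : EuclideanSpace ℝ (Fin 3)) :
    rotThird (θ + 2 * Real.pi) x = rotThird θ x := by
  simp only [rotThird_apply, Real.cos_add_two_pi, Real.sin_add_two_pi]

theorem continuous_rotThird :
    Continuous fun z : ℝ × EuclideanSpace ℝ (Fin 3) => rotThird z.1 z.2 := by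
  simp only [rotThird_apply]
  refine (PiLp.continuous_toLp 2 _).comp (continuous_pi fun i => ?_)
  fin_cases i <;> simp <;> fun_prop

theorem exists_rotThird_eq (x : EuclideanSpace ℝ (Fin 3)) :
    ∃ α, x = rotThird α !₂[√(x 0 ^ 2 + x 1 ^ 2), 0, x 2] := by
  refine ⟨Complex.arg ⟨x 0, x 1⟩, ?_⟩
  have hn : ‖(⟨x 0, x 1⟩ : ℂ)‖ = √(x 0 ^ 2 + x 1 ^ 2) := by
    rw [Complex.norm_def, Complex.normSq_mk]; congr 1; ring
  have h1 := Complex.norm_mul_cos_arg ⟨x 0, x 1⟩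
  have h2 := Complex.norm_mul_sin_arg ⟨x 0, x 1⟩
  rw [hn] at h1 h2
  conv_lhs => rw [eq_vec3 x]
  rw [rotThird_apply]
  simp only at *
  ext i; fin_cases i <;> simp <;> linarith

/-- The average of a function over the rotations around the third axis, up to a factor. -/
noncomputable def axisAverage (f : EuclideanSpace ℝ (Fin 3) → ℝ)
    (x : EuclideanSpace ℝ (Fin 3)) : ℝ :=
  ∫ θ in (0 : ℝ)..2 * Real.pi, f (rotThird θ x)

theorem axisAverage_rotThird (f : EuclideanSpace ℝ (Fin 3) → ℝ) (α : ℝ)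
    (x : EuclideanSpace ℝ (Fin 3)) : axisAverage f (rotThird α x) = axisAverage f x := by
  unfold axisAverage
  simp only [rotThird_rotThird]
  rw [intervalIntegral.integral_comp_add_right (fun θ => f (rotThird θ x))]
  have hper : Function.Periodic (fun θ => f (rotThird θ x)) (2 * Real.pi) := fun θ => by
    simp only [rotThird_two_pi_add]
  have := hper.intervalIntegral_add_eq α 0
  rw [zero_add] at this
  rw [zero_add, add_comm, this]

section Average

variable {f : EuclideanSpace ℝ (Fin 3) → ℝ} {w : ℝ}

theorem continuous_comp_rotThird (hcont : ∀ x, x ≠ 0 → ContinuousAt f x)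
    {x : EuclideanSpace ℝ (Fin 3)} (hx : x ≠ 0) : Continuous fun θ => f (rotThird θ x) := by
  rw [continuous_iff_continuousAt]
  intro θ
  have h1 : ContinuousAt (fun θ => rotThird θ x) θ :=
    (continuous_rotThird.comp (continuous_id.prodMk continuous_const)).continuousAt
  exact ContinuousAt.comp (f := fun θ => rotThird θ x)
    (hcont _ ((map_ne_zero_iff _ (rotThird θ).injective).mpr hx)) h1

theorem IsFrameFunction.isFrameFunction_axisAverage (hf : IsFrameFunction f 0)
    (hcont : ∀ x, x ≠ 0 → ContinuousAt f x) : IsFrameFunction (axisAverage f) 0 where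
  smul t ht x := by
    unfold axisAverage
    simp only [map_smul, hf.smul t ht]
  sum_eq x y z hx hy hz hxy hxz hyz := by
    unfold axisAverage
    have hi : ∀ x, x ≠ 0 → IntervalIntegrable (fun θ => f (rotThird θ x)) MeasureTheory.volume 0
        (2 * Real.pi) := fun x hx => (continuous_comp_rotThird hcont hx).intervalIntegrable _ _
    rw [← intervalIntegral.integral_add (hi x hx) (hi y hy),
      ← intervalIntegral.integral_add ((hi x hx).add (hi y hy)) (hi z hz)]
    simp only [fun θ => (hf.comp (rotThird θ)).sum_eq x y z hx hy hz hxy hxz hyz]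
    simp

theorem IsFrameFunction.axisAverage_eq_latitude (hf : IsFrameFunction f 0)
    {x : EuclideanSpace ℝ (Fin 3)} (hx : ‖x‖ = 1) :
    axisAverage f x = axisAverage f !₂[√(1 - x 2 ^ 2), 0, √(x 2 ^ 2)] := by
  obtain ⟨α, hα⟩ := exists_rotThird_eq x
  have hn : x 0 ^ 2 + x 1 ^ 2 = 1 - x 2 ^ 2 := by
    have := EuclideanSpace.norm_sq_eq x
    simp only [hx, Fin.sum_univ_three, Real.norm_eq_abs, sq_abs] at this
    linarith
  have h1 : axisAverage f x = axisAverage f !₂[√(1 - x 2 ^ 2), 0, x 2] := by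
    conv_lhs => rw [hα, axisAverage_rotThird, hn]
  rw [h1, Real.sqrt_sq_eq_abs]
  rcases abs_choice (x 2) with h | h
  · rw [h]
  · have e : (!₂[√(1 - x 2 ^ 2), 0, x 2] : EuclideanSpace ℝ (Fin 3))
        = (-1 : ℝ) • rotThird Real.pi !₂[√(1 - x 2 ^ 2), 0, -x 2] := by
      rw [rotThird_apply]
      ext i; fin_cases i <;> simp
    rw [h, e]
    have hs : ∀ y, axisAverage f ((-1 : ℝ) • y) = axisAverage f y := by
      intro y
      unfold axisAverage
      simp only [map_smul, hf.smul (-1) (by norm_num)]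
    rw [hs, axisAverage_rotThird]

/-- The axial average of a continuous bounded frame function of weight zero is the second
zonal harmonic. -/
theorem IsFrameFunction.axisAverage_eq (hf : IsFrameFunction f 0)
    (hcont : ∀ x, x ≠ 0 → ContinuousAt f x) {C : ℝ} (hC : ∀ x, x ≠ 0 → |f x| ≤ C)
    {x : EuclideanSpace ℝ (Fin 3)} (hx : ‖x‖ = 1) :
    axisAverage f x = Real.pi * f !₂[0, 0, 1] * (3 * x 2 ^ 2 - 1) := by
  set g := axisAverage f with hg
  have hgf : IsFrameFunction g 0 := hf.isFrameFunction_axisAverage hcont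
  set φ : ℝ → ℝ := fun t => g !₂[√(1 - t), 0, √t] with hφ
  have hlat : ∀ x : EuclideanSpace ℝ (Fin 3), ‖x‖ = 1 → g x = φ (x 2 ^ 2) :=
    fun x hx => hf.axisAverage_eq_latitude hx
  have hsum : ∀ a b c : ℝ, 0 ≤ a → 0 ≤ b → 0 ≤ c → a + b + c = 1 → φ a + φ b + φ c = 0 := by
    intro a b c ha hb hc habc
    have hn : ‖(!₂[√a, √b, √c] : EuclideanSpace ℝ (Fin 3))‖ = 1 := by
      rw [← sq_eq_sq₀ (norm_nonneg _) (by norm_num), EuclideanSpace.norm_sq_eq]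
      simp [Fin.sum_univ_three, Real.sq_sqrt, *]
    obtain ⟨R, hR⟩ := exists_isometry_pole hn
    set e : Fin 3 → EuclideanSpace ℝ (Fin 3) := fun i => R.symm (EuclideanSpace.single i 1) with he
    have he1 : ∀ i, ‖e i‖ = 1 := fun i => by simp [he]
    have heo : ∀ i j, i ≠ j → ⟪e i, e j⟫_ℝ = 0 := fun i j hij => by
      simp [he, EuclideanSpace.inner_single_left, hij]
    have hco : ∀ i, e i 2 = (!₂[√a, √b, √c] : EuclideanSpace ℝ (Fin 3)) i := by
      intro i
      have h1 : e i 2 = ⟪e i, !₂[0, 0, 1]⟫_ℝ := by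
        rw [eq_vec3 (e i), inner_vec3]; simp
      rw [h1, ← hR, he]
      simp only
      rw [← R.inner_map_map, R.apply_symm_apply, EuclideanSpace.inner_single_left]
      simp
    have hne : ∀ i, e i ≠ 0 := fun i h => by simpa [h] using he1 i
    have := hgf.sum_eq (e 0) (e 1) (e 2) (hne 0) (hne 1) (hne 2) (heo 0 1 (by decide))
      (heo 0 2 (by decide)) (heo 1 2 (by decide))
    rw [hlat _ (he1 0), hlat _ (he1 1), hlat _ (he1 2), hco, hco, hco] at this
    simpa [Real.sq_sqrt, ha, hb, hc] using this
  have hφC : ∀ t, 0 ≤ t → t ≤ 1 → |φ t| ≤ C * (2 * Real.pi) := by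
    intro t h0 h1
    have hne : (!₂[√(1 - t), 0, √t] : EuclideanSpace ℝ (Fin 3)) ≠ 0 :=
      vec3_ne_zero (by rw [Real.sq_sqrt h0, Real.sq_sqrt (by linarith)]; norm_num)
    have := intervalIntegral.norm_integral_le_of_norm_le_const (a := 0) (b := 2 * Real.pi) (C := C)
      (f := fun θ => f (rotThird θ !₂[√(1 - t), 0, √t]))
      (fun θ _ => hC _ ((map_ne_zero_iff _ (rotThird θ).injective).mpr hne))
    rwa [sub_zero, abs_of_pos Real.two_pi_pos] at this
  have h10 : φ 1 + 2 * φ 0 = 0 := by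
    linarith [hsum 1 0 0 (by norm_num) le_rfl le_rfl (by norm_num)]
  have hφ1 : φ 1 = 2 * Real.pi * f !₂[0, 0, 1] := by
    simp only [hφ, hg, axisAverage]
    have : ∀ θ, rotThird θ !₂[√(1 - 1), 0, √1] = !₂[0, 0, 1] := by
      intro θ; rw [rotThird_apply]; simp
    simp only [this, intervalIntegral.integral_const, smul_eq_mul, sub_zero]
  have haff : ∀ t, 0 ≤ t → t ≤ 1 → φ t - φ 0 - t * (φ 1 - φ 0) = 0 := by
    intro t h0 h1
    refine eq_zero_of_bounded_additive (d := fun t => φ t - φ 0 - t * (φ 1 - φ 0))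
      (C := C * (2 * Real.pi) + |φ 0| + |φ 1 - φ 0|) ?_ (by ring) ?_ h0 h1
    · intro s hs0 hs1
      have h3 : |s * (φ 1 - φ 0)| ≤ |φ 1 - φ 0| := by
        rw [abs_mul, abs_of_nonneg hs0]
        exact mul_le_of_le_one_left (abs_nonneg _) hs1
      calc |φ s - φ 0 - s * (φ 1 - φ 0)| ≤ |φ s - φ 0| + |s * (φ 1 - φ 0)| := abs_sub _ _
        _ ≤ |φ s| + |φ 0| + |s * (φ 1 - φ 0)| := by gcongr; exact abs_sub _ _
        _ ≤ _ := by gcongr; exact hφC s hs0 hs1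
    · intro s u hs hu hsu
      have e1 := hsum s u (1 - s - u) hs hu (by linarith) (by ring)
      have e2 := hsum (s + u) 0 (1 - s - u) (by linarith) le_rfl (by linarith) (by ring)
      linear_combination e2 - e1
  have hx2 : x 2 ^ 2 ≤ 1 := by
    have := EuclideanSpace.norm_sq_eq x
    simp only [hx, Fin.sum_univ_three, Real.norm_eq_abs, sq_abs] at this
    nlinarith [sq_nonneg (x 0), sq_nonneg (x 1)]
  rw [hlat x hx]
  linear_combination haff (x 2 ^ 2) (sq_nonneg _) hx2 + (1 / 2 - x 2 ^ 2 / 2) * h10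
    + ((3 * x 2 ^ 2 - 1) / 2) * hφ1

theorem continuous_quadExt (hcont : ∀ x, x ≠ 0 → ContinuousAt f x) {C : ℝ}
    (hC : ∀ x, x ≠ 0 → |f x| ≤ C) : Continuous (quadExt f) := by
  rw [continuous_iff_continuousAt]
  intro x
  by_cases hx : x = 0
  · subst hx
    have h0 : quadExt f 0 = 0 := by simp [quadExt]
    rw [ContinuousAt, h0]
    have hlim : Filter.Tendsto (fun y : EuclideanSpace ℝ (Fin 3) => ‖y‖ ^ 2 * C) (nhds 0)
        (nhds 0) := by
      have : Continuous (fun y : EuclideanSpace ℝ (Fin 3) => ‖y‖ ^ 2 * C) := by fun_prop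
      simpa using this.tendsto 0
    refine squeeze_zero_norm (fun y => ?_) hlim
    by_cases hy : y = 0
    · simp [hy, quadExt]
    · rw [quadExt, norm_mul, norm_pow, norm_norm]
      gcongr
      exact hC y hy
  · exact (continuous_norm.pow 2).continuousAt.mul (hcont x hx)

theorem setIntegral_closedBall_comp_isometry
    (R : EuclideanSpace ℝ (Fin 3) ≃ₗᵢ[ℝ] EuclideanSpace ℝ (Fin 3))
    (G : EuclideanSpace ℝ (Fin 3) → ℝ) :
    ∫ x in Metric.closedBall 0 1, G (R x) = ∫ x in Metric.closedBall 0 1, G x := by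
  have h := R.measurePreserving.setIntegral_preimage_emb
    R.toHomeomorph.measurableEmbedding G (Metric.closedBall 0 1)
  have hpre : R ⁻¹' Metric.closedBall 0 1 = Metric.closedBall 0 1 := by
    rw [R.preimage_closedBall, map_zero]
  rwa [hpre] at h

theorem integrableOn_closedBall {G : EuclideanSpace ℝ (Fin 3) → ℝ} (hG : Continuous G) :
    MeasureTheory.IntegrableOn G (Metric.closedBall 0 1) :=
  hG.continuousOn.integrableOn_compact (isCompact_closedBall 0 1)

theorem IsFrameFunction.axisAverage_quadExt (hf : IsFrameFunction f 0)
    (hcont : ∀ x, x ≠ 0 → ContinuousAt f x) {C : ℝ} (hC : ∀ x, x ≠ 0 → |f x| ≤ C)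
    (x : EuclideanSpace ℝ (Fin 3)) :
    axisAverage (quadExt f) x = Real.pi * f !₂[0, 0, 1] * (3 * x 2 ^ 2 - ‖x‖ ^ 2) := by
  by_cases hx : x = 0
  · simp [hx, axisAverage, quadExt]
  have hn : ‖x‖ ≠ 0 := by simpa using hx
  have h := hf.axisAverage_eq hcont hC (x := ‖x‖⁻¹ • x) (norm_smul_inv_norm hx)
  have h2 : axisAverage (quadExt f) x = ‖x‖ ^ 2 * axisAverage f (‖x‖⁻¹ • x) := by
    unfold axisAverage quadExt
    simp only [LinearIsometry.norm_map, map_smul, hf.smul _ (inv_ne_zero hn)]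
    rw [intervalIntegral.integral_const_mul]
  rw [h2, h]
  simp only [PiLp.smul_apply, smul_eq_mul]
  field_simp

theorem IsFrameFunction.integral_quadExt_pole (hf : IsFrameFunction f 0)
    (hcont : ∀ x, x ≠ 0 → ContinuousAt f x) {C : ℝ} (hC : ∀ x, x ≠ 0 → |f x| ≤ C) :
    ∫ x in Metric.closedBall (0 : EuclideanSpace ℝ (Fin 3)) 1,
        quadExt f x * (3 * x 2 ^ 2 - ‖x‖ ^ 2) =
      f !₂[0, 0, 1] * ((∫ x in Metric.closedBall (0 : EuclideanSpace ℝ (Fin 3)) 1,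
        (3 * x 2 ^ 2 - ‖x‖ ^ 2) ^ 2) / 2) := by
  have hF := continuous_quadExt hcont hC
  set B := Metric.closedBall (0 : EuclideanSpace ℝ (Fin 3)) 1
  have hrot : ∀ θ, ∫ x in B, quadExt f (rotThird θ x) * (3 * x 2 ^ 2 - ‖x‖ ^ 2) =
      ∫ x in B, quadExt f x * (3 * x 2 ^ 2 - ‖x‖ ^ 2) := by
    intro θ
    have h := setIntegral_closedBall_comp_isometry ((rotThird θ).toLinearIsometryEquiv rfl)
      (fun x => quadExt f x * (3 * x 2 ^ 2 - ‖x‖ ^ 2))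
    rw [← h]
    simp only [LinearIsometry.coe_toLinearIsometryEquiv, LinearIsometry.norm_map]
    rfl
  have hjoint : Continuous (Function.uncurry fun (θ : ℝ) (x : EuclideanSpace ℝ (Fin 3)) =>
      quadExt f (rotThird θ x) * (3 * x 2 ^ 2 - ‖x‖ ^ 2)) := by
    refine Continuous.mul (hF.comp continuous_rotThird) ?_
    fun_prop
  have hcpt := hjoint.continuousOn.integrableOn_compact (μ := MeasureTheory.volume.prod
    MeasureTheory.volume) ((isCompact_uIcc (a := (0 : ℝ)) (b := 2 * Real.pi)).prod
      (isCompact_closedBall (0 : EuclideanSpace ℝ (Fin 3)) 1))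
  have hswap := MeasureTheory.intervalIntegral_integral_swap (a := 0) (b := 2 * Real.pi)
    (μ := MeasureTheory.volume.restrict B)
    (f := fun θ x => quadExt f (rotThird θ x) * (3 * x 2 ^ 2 - ‖x‖ ^ 2)) (by
      rw [MeasureTheory.Measure.prod_restrict]
      exact hcpt.mono_set (Set.prod_mono Set.uIoc_subset_uIcc subset_rfl))
  simp only [hrot, intervalIntegral.integral_mul_const] at hswap
  have hav : ∀ x, ∫ θ in (0 : ℝ)..2 * Real.pi, quadExt f (rotThird θ x) =
      Real.pi * f !₂[0, 0, 1] * (3 * x 2 ^ 2 - ‖x‖ ^ 2) := hf.axisAverage_quadExt hcont hC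
  simp only [hav, intervalIntegral.integral_const, mul_assoc, ← pow_two, smul_eq_mul, sub_zero,
    MeasureTheory.integral_const_mul] at hswap
  have hpi := Real.pi_pos
  field_simp at hswap ⊢
  linarith

theorem integral_zonal_sq_pos :
    0 < ∫ x in Metric.closedBall (0 : EuclideanSpace ℝ (Fin 3)) 1,
      (3 * x 2 ^ 2 - ‖x‖ ^ 2) ^ 2 := by
  have hc : Continuous fun x : EuclideanSpace ℝ (Fin 3) => (3 * x 2 ^ 2 - ‖x‖ ^ 2) ^ 2 := by
    fun_prop
  rw [MeasureTheory.setIntegral_pos_iff_support_of_nonneg_ae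
    (Filter.Eventually.of_forall fun x => by positivity) (integrableOn_closedBall hc)]
  have ho : IsOpen (Function.support (fun x : EuclideanSpace ℝ (Fin 3) =>
      (3 * x 2 ^ 2 - ‖x‖ ^ 2) ^ 2) ∩ Metric.ball 0 1) :=
    hc.isOpen_support.inter Metric.isOpen_ball
  refine (ho.measure_pos MeasureTheory.volume ?_).trans_le
    (MeasureTheory.measure_mono (Set.inter_subset_inter_right _ Metric.ball_subset_closedBall))
  have hn : ‖(!₂[0, 0, 1 / 2] : EuclideanSpace ℝ (Fin 3))‖ = 1 / 2 := by
    rw [← sq_eq_sq₀ (norm_nonneg _) (by norm_num), EuclideanSpace.norm_sq_eq]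
    simp [Fin.sum_univ_three]
  refine ⟨!₂[0, 0, 1 / 2], ?_, ?_⟩
  · rw [Function.mem_support, hn]
    simp; norm_num
  · rw [Metric.mem_ball, dist_zero_right, hn]
    norm_num

/-- Continuous frame functions of weight zero reproduce under the second zonal kernel. -/
theorem IsFrameFunction.integral_quadExt (hf : IsFrameFunction f 0)
    (hcont : ∀ x, x ≠ 0 → ContinuousAt f x) {C : ℝ} (hC : ∀ x, x ≠ 0 → |f x| ≤ C)
    (p : EuclideanSpace ℝ (Fin 3)) :
    ∫ x in Metric.closedBall (0 : EuclideanSpace ℝ (Fin 3)) 1,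
        quadExt f x * (3 * ⟪x, p⟫_ℝ ^ 2 - ‖x‖ ^ 2 * ‖p‖ ^ 2) =
      quadExt f p * ((∫ x in Metric.closedBall (0 : EuclideanSpace ℝ (Fin 3)) 1,
        (3 * x 2 ^ 2 - ‖x‖ ^ 2) ^ 2) / 2) := by
  by_cases hp : p = 0
  · simp [hp, quadExt]
  have hn : ‖p‖ ≠ 0 := by simpa using hp
  obtain ⟨R, hR⟩ := exists_isometry_pole (p := (‖p‖⁻¹ : ℝ) • p) (norm_smul_inv_norm hp)
  have hRp : p = ‖p‖ • R !₂[0, 0, 1] := by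
    rw [hR, smul_smul, mul_inv_cancel₀ hn, one_smul]
  have hinj : ∀ x, x ≠ 0 → R x ≠ 0 := fun x hx => (map_ne_zero_iff R R.injective).mpr hx
  have h := (hf.comp R.toLinearIsometry).integral_quadExt_pole
    (fun x hx => ContinuousAt.comp (f := R) (hcont _ (hinj x hx)) R.continuous.continuousAt)
    (fun x hx => hC _ (hinj x hx))
  simp only [LinearIsometryEquiv.coe_toLinearIsometry, hR, hf.smul _ (inv_ne_zero hn)] at h
  rw [← setIntegral_closedBall_comp_isometry R
    (fun x => quadExt f x * (3 * ⟪x, p⟫_ℝ ^ 2 - ‖x‖ ^ 2 * ‖p‖ ^ 2))]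
  have hpt : ∀ x, quadExt f (R x) * (3 * ⟪R x, p⟫_ℝ ^ 2 - ‖R x‖ ^ 2 * ‖p‖ ^ 2) =
      ‖p‖ ^ 2 * (quadExt (fun x => f (R x)) x * (3 * x 2 ^ 2 - ‖x‖ ^ 2)) := by
    intro x
    have hin : ⟪R x, p⟫_ℝ = ‖p‖ * x 2 := by
      rw [hRp, inner_smul_right, R.inner_map_map, eq_vec3 x, inner_vec3]
      simp [← hRp]
    rw [hin]
    simp only [quadExt, R.norm_map]
    ring
  simp only [hpt, MeasureTheory.integral_const_mul]
  rw [h, quadExt]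
  ring

/-- Nonnegative frame functions on `ℝ³` are restrictions of quadratic forms. -/
theorem IsFrameFunction.parallelogram (hf : IsFrameFunction f w) (h0 : ∀ x, 0 ≤ f x)
    (p q : EuclideanSpace ℝ (Fin 3)) :
    quadExt f (p + q) + quadExt f (p - q) = 2 * quadExt f p + 2 * quadExt f q := by
  set f₀ : EuclideanSpace ℝ (Fin 3) → ℝ := fun x => f x - w / 3
  have hf₀ : IsFrameFunction f₀ 0 := by
    have := hf.sub_const (w / 3)
    rwa [show w - 3 * (w / 3) = 0 by ring] at this
  have hcont : ∀ x, x ≠ 0 → ContinuousAt f₀ x := fun x hx => (hf.continuousAt h0 hx).sub_const _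
  have hC : ∀ x, x ≠ 0 → |f₀ x| ≤ |w| := by
    intro x hx
    obtain ⟨y, hy, hxy, -⟩ := exists_ne_zero_inner_eq_zero x x
    obtain ⟨z, hz, hxz, hyz⟩ := exists_ne_zero_inner_eq_zero x y
    have := hf.sum_eq x y z hx hy hz hxy hxz hyz
    have hw : 0 ≤ w := by linarith [h0 x, h0 y, h0 z]
    rw [abs_of_nonneg hw, abs_le]
    constructor <;> simp only [f₀] <;> linarith [h0 x, h0 y, h0 z]
  have hF := continuous_quadExt hcont hC
  set κ := (∫ x in Metric.closedBall (0 : EuclideanSpace ℝ (Fin 3)) 1,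
        (3 * x 2 ^ 2 - ‖x‖ ^ 2) ^ 2) / 2
  have hκ : 0 < κ := half_pos integral_zonal_sq_pos
  have hI := hf₀.integral_quadExt hcont hC
  have hInt : ∀ p : EuclideanSpace ℝ (Fin 3), MeasureTheory.IntegrableOn
      (fun x => quadExt f₀ x * (3 * ⟪x, p⟫_ℝ ^ 2 - ‖x‖ ^ 2 * ‖p‖ ^ 2))
      (Metric.closedBall 0 1) := fun p => integrableOn_closedBall (by fun_prop)
  have hpar := parallelogram_law_with_norm ℝ p q
  have hsum : quadExt f₀ (p + q) * κ + quadExt f₀ (p - q) * κ =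
      2 * (quadExt f₀ p * κ) + 2 * (quadExt f₀ q * κ) := by
    rw [← hI, ← hI, ← hI, ← hI, ← MeasureTheory.integral_const_mul,
      ← MeasureTheory.integral_const_mul, ← MeasureTheory.integral_add (hInt _) (hInt _),
      ← MeasureTheory.integral_add ((hInt _).const_mul 2) ((hInt _).const_mul 2)]
    congr 1
    ext x
    rw [inner_add_right, inner_sub_right]
    linear_combination (-quadExt f₀ x * ‖x‖ ^ 2) * hpar
  have hsum' : quadExt f₀ (p + q) + quadExt f₀ (p - q) = 2 * quadExt f₀ p + 2 * quadExt f₀ q := by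
    apply mul_right_cancel₀ hκ.ne'
    linarith
  simp only [quadExt, f₀] at hsum' ⊢
  linear_combination hsum' + (w / 3) * hpar

end Average

section Gleason

variable {H : Type*} [NormedAddCommGroup H] [InnerProductSpace ℂ H] [CompleteSpace H]

/-- A finite, completely additive, positive measure on the projections of a Hilbert space. -/
structure IsQuantumMeasure (μ : (H →L[ℂ] H) → ℝ) : Prop where
  nonneg : ∀ e, IsProjectionOp e → 0 ≤ μ e
  hasSum : ∀ (ι : Type) (p : ι → (H →L[ℂ] H)) (q : H →L[ℂ] H),
    (∀ i, IsProjectionOp (p i)) → IsProjectionOp q → (∀ i j, i ≠ j → p i * p j = 0) →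
    (∀ v, HasSum (fun i => p i v) (q v)) → HasSum (fun i => μ (p i)) (μ q)

theorem isProjectionOp_starProjection (U : Submodule ℂ H) [U.HasOrthogonalProjection] :
    IsProjectionOp U.starProjection :=
  ⟨isStarProjection_starProjection.isIdempotentElem, isStarProjection_starProjection.isSelfAdjoint⟩

/-- The projection onto the line spanned by a vector. -/
noncomputable def lineProj (x : H) : H →L[ℂ] H := (ℂ ∙ x).starProjection

theorem isProjectionOp_lineProj (x : H) : IsProjectionOp (lineProj x) :=
  isProjectionOp_starProjection _

theorem lineProj_apply (x v : H) : lineProj x v = (⟪x, v⟫_ℂ / (‖x‖ ^ 2 : ℝ)) • x := by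
  rw [lineProj, Submodule.starProjection_singleton]
  rfl

theorem lineProj_smul {c : ℂ} (hc : c ≠ 0) (x : H) : lineProj (c • x) = lineProj x := by
  unfold lineProj
  congr 1
  exact Submodule.span_singleton_smul_eq (IsUnit.mk0 c hc) x

theorem lineProj_mul_lineProj {x y : H} (h : ⟪x, y⟫_ℂ = 0) : lineProj x * lineProj y = 0 := by
  ext v
  simp [lineProj_apply, h]

theorem isProjectionOp_one_sub {p : H →L[ℂ] H} (hp : IsProjectionOp p) :
    IsProjectionOp (1 - p) :=
  ⟨hp.1.one_sub, (IsSelfAdjoint.one _).sub hp.2⟩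

theorem isProjectionOp_one : IsProjectionOp (1 : H →L[ℂ] H) :=
  ⟨IsIdempotentElem.one, IsSelfAdjoint.one _⟩

namespace IsQuantumMeasure

variable {μ : (H →L[ℂ] H) → ℝ}

theorem map_sum_fintype (hμ : IsQuantumMeasure μ) {ι : Type} [Fintype ι] {p : ι → (H →L[ℂ] H)}
    {q : H →L[ℂ] H} (hp : ∀ i, IsProjectionOp (p i)) (hq : IsProjectionOp q)
    (horth : ∀ i j, i ≠ j → p i * p j = 0) (hsum : ∀ v, ∑ i, p i v = q v) :
    ∑ i, μ (p i) = μ q :=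
  (hasSum_fintype _).unique
    (hμ.hasSum ι p q hp hq horth fun v => hsum v ▸ hasSum_fintype fun i => p i v)

theorem map_add (hμ : IsQuantumMeasure μ) {p q r : H →L[ℂ] H} (hp : IsProjectionOp p)
    (hq : IsProjectionOp q) (hr : IsProjectionOp r) (hpq : p * q = 0) (hqp : q * p = 0)
    (h : ∀ v, p v + q v = r v) : μ p + μ q = μ r := by
  have := hμ.map_sum_fintype (p := ![p, q]) (q := r)
    (by intro i; fin_cases i <;> simpa) hr
    (by intro i j hij; fin_cases i <;> fin_cases j <;> first | exact absurd rfl hij | simpa)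
    (by intro v; simpa [Fin.sum_univ_two] using h v)
  simpa [Fin.sum_univ_two] using this

theorem le_map_one (hμ : IsQuantumMeasure μ) {p : H →L[ℂ] H} (hp : IsProjectionOp p) :
    μ p ≤ μ 1 := by
  have h : μ p + μ (1 - p) = μ 1 := hμ.map_add hp (isProjectionOp_one_sub hp) isProjectionOp_one
    hp.1.mul_one_sub_self hp.1.one_sub_mul_self (by simp)
  linarith [hμ.nonneg _ (isProjectionOp_one_sub hp)]

end IsQuantumMeasure

/-- The real-linear embedding of `ℝ³` attached to three vectors. -/
noncomputable def frameEmbed (e : Fin 3 → H) (u : EuclideanSpace ℝ (Fin 3)) : H :=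
  ∑ i, (u i : ℂ) • e i

section frameEmbed

variable (e : Fin 3 → H)

theorem frameEmbed_add (u v : EuclideanSpace ℝ (Fin 3)) :
    frameEmbed e (u + v) = frameEmbed e u + frameEmbed e v := by
  simp [frameEmbed, add_smul, Finset.sum_add_distrib]

theorem frameEmbed_sub (u v : EuclideanSpace ℝ (Fin 3)) :
    frameEmbed e (u - v) = frameEmbed e u - frameEmbed e v := by
  simp [frameEmbed, sub_smul, Finset.sum_sub_distrib]

theorem frameEmbed_smul (t : ℝ) (u : EuclideanSpace ℝ (Fin 3)) :
    frameEmbed e (t • u) = (t : ℂ) • frameEmbed e u := by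
  simp [frameEmbed, smul_smul, Finset.smul_sum, -Complex.coe_smul]

variable {e}

theorem inner_frameEmbed (he : Orthonormal ℂ e) (u v : EuclideanSpace ℝ (Fin 3)) :
    ⟪frameEmbed e u, frameEmbed e v⟫_ℂ = (⟪u, v⟫_ℝ : ℂ) := by
  rw [frameEmbed, frameEmbed, he.inner_sum, PiLp.inner_apply]
  simp [mul_comm]

theorem norm_frameEmbed (he : Orthonormal ℂ e) (u : EuclideanSpace ℝ (Fin 3)) :
    ‖frameEmbed e u‖ = ‖u‖ := by
  rw [← sq_eq_sq₀ (norm_nonneg _) (norm_nonneg _), norm_sq_eq_re_inner (𝕜 := ℂ),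
    inner_frameEmbed he, ← real_inner_self_eq_norm_sq]
  rfl

theorem mem_span_of_orthogonal {x : Fin 3 → EuclideanSpace ℝ (Fin 3)} (h0 : ∀ i, x i ≠ 0)
    (h : Pairwise fun i j => ⟪x i, x j⟫_ℝ = 0) (u : EuclideanSpace ℝ (Fin 3)) :
    ∃ c : Fin 3 → ℝ, ∑ i, c i • x i = u := by
  have hli := linearIndependent_of_ne_zero_of_inner_eq_zero h0 h
  have hs := hli.span_eq_top_of_card_eq_finrank (by simp)
  have hu : u ∈ Submodule.span ℝ (Set.range x) := hs ▸ Submodule.mem_top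
  exact Submodule.mem_span_range_iff_exists_fun ℝ |>.mp hu

theorem inner_lineProj_sub (x v : H) : ⟪x, v - lineProj x v⟫_ℂ = 0 := by
  by_cases hx : x = 0
  · simp [hx]
  have hn : (‖x‖ : ℂ) ≠ 0 := by simpa using hx
  rw [lineProj_apply, inner_sub_right, inner_smul_right, inner_self_eq_norm_sq_to_K]
  push_cast
  simp [hn]

instance hasOrthogonalProjection_span_range (e : Fin 3 → H) :
    (Submodule.span ℂ (Set.range e)).HasOrthogonalProjection :=
  have := FiniteDimensional.span_of_finite ℂ (Set.finite_range e)
  inferInstance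

theorem sum_lineProj_frameEmbed (he : Orthonormal ℂ e) {x : Fin 3 → EuclideanSpace ℝ (Fin 3)}
    (h0 : ∀ i, x i ≠ 0) (h : Pairwise fun i j => ⟪x i, x j⟫_ℝ = 0) (v : H) :
    ∑ i, lineProj (frameEmbed e (x i)) v =
      (Submodule.span ℂ (Set.range e)).starProjection v := by
  symm
  apply Submodule.eq_starProjection_of_mem_of_inner_eq_zero
  · refine Submodule.sum_mem _ fun i _ => ?_
    rw [lineProj_apply]
    refine Submodule.smul_mem _ _ (Submodule.sum_mem _ fun j _ => ?_)
    exact Submodule.smul_mem _ _ (Submodule.subset_span ⟨j, rfl⟩)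
  · have hx : ∀ j, ⟪frameEmbed e (x j), v - ∑ i, lineProj (frameEmbed e (x i)) v⟫_ℂ = 0 := by
      intro j
      rw [← Finset.add_sum_erase _ _ (Finset.mem_univ j), ← sub_sub, inner_sub_right,
        inner_lineProj_sub, inner_sum, zero_sub, neg_eq_zero]
      refine Finset.sum_eq_zero fun i hi => ?_
      rw [lineProj_apply, inner_smul_right, inner_frameEmbed he,
        h (Finset.ne_of_mem_erase hi).symm]
      simp
    have hsub : Submodule.span ℂ (Set.range e) ≤
        (ℂ ∙ (v - ∑ i, lineProj (frameEmbed e (x i)) v))ᗮ := by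
      rw [Submodule.span_le]
      rintro _ ⟨k, rfl⟩
      obtain ⟨c, hc⟩ := mem_span_of_orthogonal h0 h (EuclideanSpace.single k 1)
      have hk : e k = frameEmbed e (EuclideanSpace.single k 1) := by
        simp [frameEmbed, ite_smul]
      have hk' : e k = ∑ i, (c i : ℂ) • frameEmbed e (x i) := by
        rw [hk, ← hc]
        simp [frameEmbed, Finset.smul_sum, smul_smul, Finset.sum_smul, -Complex.coe_smul]
        rw [Finset.sum_comm]
      rw [SetLike.mem_coe, Submodule.mem_orthogonal_singleton_iff_inner_left, hk', sum_inner]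
      exact Finset.sum_eq_zero fun i _ => by rw [inner_smul_left, hx, mul_zero]
    intro w hw
    exact Submodule.mem_orthogonal_singleton_iff_inner_right.mp (hsub hw)

end frameEmbed

namespace IsQuantumMeasure

variable {μ : (H →L[ℂ] H) → ℝ}

theorem isFrameFunction (hμ : IsQuantumMeasure μ) {e : Fin 3 → H} (he : Orthonormal ℂ e) :
    IsFrameFunction (fun u => μ (lineProj (frameEmbed e u)))
      (μ (Submodule.span ℂ (Set.range e)).starProjection) where
  smul t ht x := by
    simp only [frameEmbed_smul]
    rw [lineProj_smul (by exact_mod_cast ht)]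
  sum_eq x y z hx hy hz hxy hxz hyz := by
    have h0 : ∀ i, (![x, y, z] : Fin 3 → _) i ≠ 0 := by
      intro i; fin_cases i <;> simpa
    have horth : Pairwise fun i j =>
        ⟪(![x, y, z] : Fin 3 → EuclideanSpace ℝ (Fin 3)) i, ![x, y, z] j⟫_ℝ = 0 := by
      intro i j hij
      fin_cases i <;> fin_cases j <;> first | exact absurd rfl hij | simpa | simpa [real_inner_comm]
    have := hμ.map_sum_fintype (fun i => isProjectionOp_lineProj (frameEmbed e (![x, y, z] i)))
      (isProjectionOp_starProjection _)
      (fun i j hij => lineProj_mul_lineProj (by rw [inner_frameEmbed he, horth hij]; simp))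
      (sum_lineProj_frameEmbed he h0 horth)
    simpa [Fin.sum_univ_three] using this

/-- The quadratic extension of the values of a measure on lines. -/
noncomputable def _root_.quadForm (μ : (H →L[ℂ] H) → ℝ) (x : H) : ℝ := ‖x‖ ^ 2 * μ (lineProj x)

theorem quadForm_nonneg (hμ : IsQuantumMeasure μ) (x : H) : 0 ≤ quadForm μ x :=
  mul_nonneg (sq_nonneg _) (hμ.nonneg _ (isProjectionOp_lineProj x))

theorem quadForm_le (hμ : IsQuantumMeasure μ) (x : H) : quadForm μ x ≤ μ 1 * ‖x‖ ^ 2 := by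
  rw [mul_comm (μ 1)]
  exact mul_le_mul_of_nonneg_left (hμ.le_map_one (isProjectionOp_lineProj x)) (sq_nonneg _)

theorem _root_.quadForm_smul (c : ℂ) (x : H) : quadForm μ (c • x) = ‖c‖ ^ 2 * quadForm μ x := by
  by_cases hc : c = 0
  · simp [hc, quadForm]
  · rw [quadForm, quadForm, lineProj_smul hc, norm_smul]
    ring

theorem _root_.quadForm_zero : quadForm μ 0 = 0 := by simp [quadForm]

theorem _root_.quadForm_neg (x : H) : quadForm μ (-x) = quadForm μ x := by
  have := quadForm_smul (μ := μ) (-1) x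
  simpa using this

theorem parallelogram_frameEmbed (hμ : IsQuantumMeasure μ) {e : Fin 3 → H} (he : Orthonormal ℂ e)
    (p q : EuclideanSpace ℝ (Fin 3)) :
    quadForm μ (frameEmbed e p + frameEmbed e q) + quadForm μ (frameEmbed e p - frameEmbed e q) =
      2 * quadForm μ (frameEmbed e p) + 2 * quadForm μ (frameEmbed e q) := by
  have := (hμ.isFrameFunction he).parallelogram
    (fun x => hμ.nonneg _ (isProjectionOp_lineProj _)) p q
  simp only [quadExt, ← norm_frameEmbed he] at this
  rw [← frameEmbed_add, ← frameEmbed_sub]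
  exact this

end IsQuantumMeasure

theorem exists_unit_orthogonal (hdim : 3 ≤ Module.rank ℂ H) (u v : H) :
    ∃ w : H, ‖w‖ = 1 ∧ ⟪u, w⟫_ℂ = 0 ∧ ⟪v, w⟫_ℂ = 0 := by
  set U := Submodule.span ℂ {u, v}
  have : FiniteDimensional ℂ U := FiniteDimensional.span_of_finite ℂ (by simp)
  have hne : Uᗮ ≠ ⊥ := by
    intro h
    rw [Submodule.orthogonal_eq_bot_iff] at h
    have h1 : Module.rank ℂ U ≤ 2 := by
      refine (rank_span_le _).trans ?_
      exact (Cardinal.mk_insert_le).trans (by simp; norm_num)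
    rw [h, rank_top] at h1
    have := hdim.trans h1
    norm_num at this
  obtain ⟨w, hw, hw0⟩ := Submodule.exists_mem_ne_zero_of_ne_bot hne
  refine ⟨(‖w‖⁻¹ : ℂ) • w, by simpa using norm_smul_inv_norm (𝕜 := ℂ) hw0, ?_, ?_⟩
  · rw [inner_smul_right, hw u (Submodule.subset_span (by simp)), mul_zero]
  · rw [inner_smul_right, hw v (Submodule.subset_span (by simp)), mul_zero]

theorem exists_unit_direction (hdim : 3 ≤ Module.rank ℂ H) {u z : H} (h : ⟪u, z⟫_ℂ = 0) :
    ∃ w : H, ‖w‖ = 1 ∧ ⟪u, w⟫_ℂ = 0 ∧ z = (‖z‖ : ℂ) • w := by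
  by_cases hz : z = 0
  · obtain ⟨w, hw, huw, -⟩ := exists_unit_orthogonal hdim u u
    exact ⟨w, hw, huw, by simp [hz]⟩
  · have hn : (‖z‖ : ℂ) ≠ 0 := by simpa using hz
    refine ⟨(‖z‖⁻¹ : ℂ) • z, by simpa using norm_smul_inv_norm (𝕜 := ℂ) hz, ?_, ?_⟩
    · rw [inner_smul_right, h, mul_zero]
    · rw [smul_smul, mul_inv_cancel₀ hn, one_smul]

theorem IsQuantumMeasure.parallelogram_of_inner_real {μ : (H →L[ℂ] H) → ℝ}
    (hμ : IsQuantumMeasure μ) (hdim : 3 ≤ Module.rank ℂ H) {x y : H} {r : ℝ}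
    (hr : ⟪x, y⟫_ℂ = r) :
    quadForm μ (x + y) + quadForm μ (x - y) = 2 * quadForm μ x + 2 * quadForm μ y := by
  by_cases hx : x = 0
  · simp only [hx, zero_add, zero_sub, quadForm_neg, quadForm_zero]
    ring
  have hn : ‖x‖ ≠ 0 := by simpa using hx
  obtain ⟨a, ha, -, hxa⟩ := exists_unit_direction hdim (inner_zero_left x : ⟪(0 : H), x⟫_ℂ = 0)
  have hay : ⟪a, y⟫_ℂ = ((r / ‖x‖ : ℝ) : ℂ) := by
    rw [hxa, inner_smul_left, Complex.conj_ofReal] at hr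
    rw [Complex.ofReal_div, ← hr, mul_div_cancel_left₀]
    exact_mod_cast hn
  have haa : ⟪a, a⟫_ℂ = 1 := by rw [inner_self_eq_norm_sq_to_K, ha]; simp
  have hz : ⟪a, y - ((r / ‖x‖ : ℝ) : ℂ) • a⟫_ℂ = 0 := by
    rw [inner_sub_right, inner_smul_right, haa, hay]; simp
  obtain ⟨b, hb, hab, hyb⟩ := exists_unit_direction hdim hz
  obtain ⟨c, hc, hac, hbc⟩ := exists_unit_orthogonal hdim a b
  have he : Orthonormal ℂ ![a, b, c] := by
    refine ⟨fun i => by fin_cases i <;> simpa, fun i j hij => ?_⟩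
    fin_cases i <;> fin_cases j <;>
      first | exact absurd rfl hij | simpa | simpa using inner_eq_zero_symm.mp ‹_›
  have hxe : x = frameEmbed ![a, b, c] !₂[‖x‖, 0, 0] := by
    simpa [frameEmbed, Fin.sum_univ_three] using hxa
  have hye : y = frameEmbed ![a, b, c]
      !₂[r / ‖x‖, ‖y - ((r / ‖x‖ : ℝ) : ℂ) • a‖, 0] := by
    rw [sub_eq_iff_eq_add] at hyb
    rw [add_comm] at hyb
    simpa [frameEmbed, Fin.sum_univ_three, -Complex.coe_smul] using hyb
  rw [hxe, hye]
  exact hμ.parallelogram_frameEmbed he _ _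

section Polarization

variable {V : Type*} [AddCommGroup V] {F : V → ℝ}

/-- The polarization of a real-valued function. -/
noncomputable def polarForm (F : V → ℝ) (x y : V) : ℝ := (F (x + y) - F (x - y)) / 4

theorem polarForm_add_right (hpar : ∀ x y, F (x + y) + F (x - y) = 2 * F x + 2 * F y)
    (x y z : V) : polarForm F x (y + z) = polarForm F x y + polarForm F x z := by
  have h1 := hpar (x + y) z
  have h2 := hpar (x + z) y
  have h3 := hpar (x - y) z
  have h4 := hpar (x - z) y
  rw [show x + z + y = x + y + z by abel] at h2
  rw [show x - z - y = x - y - z by abel] at h4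
  rw [show x + z - y = x - y + z by abel] at h2
  rw [show x - z + y = x + y - z by abel] at h4
  rw [polarForm, polarForm, polarForm, ← add_assoc, ← sub_sub]
  linarith

theorem polarForm_neg_right (x y : V) : polarForm F x (-y) = -polarForm F x y := by
  rw [polarForm, polarForm, sub_neg_eq_add, ← sub_eq_add_neg]
  ring

theorem add_eq_polarForm (hpar : ∀ x y, F (x + y) + F (x - y) = 2 * F x + 2 * F y) (x y : V) :
    F (x + y) = F x + F y + 2 * polarForm F x y := by
  rw [polarForm]
  linarith [hpar x y]

variable [Module ℝ V]

theorem polarForm_smul_right_of_mem_Icc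
    (hpar : ∀ x y, F (x + y) + F (x - y) = 2 * F x + 2 * F y) (h0 : ∀ x, 0 ≤ F x)
    (hsm : ∀ (t : ℝ) x, F (t • x) = t ^ 2 * F x) (x y : V) {t : ℝ} (ht0 : 0 ≤ t) (ht1 : t ≤ 1) :
    polarForm F x (t • y) = t * polarForm F x y := by
  rw [← sub_eq_zero]
  refine eq_zero_of_bounded_additive (d := fun t => polarForm F x (t • y) - t * polarForm F x y)
    (C := F x + F y + |polarForm F x y|) ?_ ?_ ?_ ht0 ht1
  · intro t ht0 ht1
    have hp := hpar x (t • y)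
    have h1 := h0 (x + t • y)
    have h2 := h0 (x - t • y)
    have hb : |polarForm F x (t • y)| ≤ F x + F y := by
      have ht : t ^ 2 * F y ≤ F y := mul_le_of_le_one_left (h0 y) (pow_le_one₀ ht0 ht1)
      have h3 : 0 ≤ t ^ 2 * F y := mul_nonneg (sq_nonneg t) (h0 y)
      rw [hsm] at hp
      rw [polarForm, abs_le]
      constructor <;> linarith [h0 x, h0 y]
    have ht : |t * polarForm F x y| ≤ |polarForm F x y| := by
      rw [abs_mul, abs_of_nonneg ht0]
      exact mul_le_of_le_one_left (abs_nonneg _) ht1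
    exact (abs_sub _ _).trans (add_le_add hb ht)
  · simp
  · intro s t _ _ _
    simp only [add_smul, polarForm_add_right hpar]
    ring

theorem polarForm_smul_right
    (hpar : ∀ x y, F (x + y) + F (x - y) = 2 * F x + 2 * F y) (h0 : ∀ x, 0 ≤ F x)
    (hsm : ∀ (t : ℝ) x, F (t • x) = t ^ 2 * F x) (t : ℝ) (x y : V) :
    polarForm F x (t • y) = t * polarForm F x y := by
  have hpos : ∀ t : ℝ, 0 ≤ t → polarForm F x (t • y) = t * polarForm F x y := by
    intro t ht
    rcases le_total t 1 with h | h
    · exact polarForm_smul_right_of_mem_Icc hpar h0 hsm x y ht h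
    · have ht0 : t ≠ 0 := by linarith
      have := polarForm_smul_right_of_mem_Icc hpar h0 hsm x (t • y) (inv_nonneg.mpr ht)
        (inv_le_one_of_one_le₀ h)
      rw [smul_smul, inv_mul_cancel₀ ht0, one_smul] at this
      rw [this, mul_inv_cancel_left₀ ht0]
  rcases le_total 0 t with h | h
  · exact hpos t h
  · have := hpos (-t) (by linarith)
    rw [neg_smul, polarForm_neg_right] at this
    linarith

end Polarization

namespace IsQuantumMeasure

variable {μ : (H →L[ℂ] H) → ℝ}

theorem quadForm_real_combination (hμ : IsQuantumMeasure μ) (hdim : 3 ≤ Module.rank ℂ H)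
    {x y : H} (hxy : ⟪x, y⟫_ℂ = 0) (s : ℝ) :
    quadForm μ (x + (s : ℂ) • y) =
      quadForm μ x + s ^ 2 * quadForm μ y + 2 * (s * polarForm (quadForm μ) x y) := by
  set F : ℝ × ℝ → ℝ := fun a => quadForm μ ((a.1 : ℂ) • x + (a.2 : ℂ) • y) with hF
  have hyx : ⟪y, x⟫_ℂ = 0 := inner_eq_zero_symm.mp hxy
  have hpar : ∀ a b, F (a + b) + F (a - b) = 2 * F a + 2 * F b := by
    intro a b
    have := hμ.parallelogram_of_inner_real hdim (x := (a.1 : ℂ) • x + (a.2 : ℂ) • y)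
      (y := (b.1 : ℂ) • x + (b.2 : ℂ) • y) (r := a.1 * b.1 * ‖x‖ ^ 2 + a.2 * b.2 * ‖y‖ ^ 2) (by
        simp only [inner_add_left, inner_add_right, inner_smul_left, inner_smul_right, hxy, hyx,
          inner_self_eq_norm_sq_to_K, Complex.conj_ofReal]
        push_cast
        simp only [Complex.coe_algebraMap]
        ring)
    rw [← this, hF]
    simp only [Prod.fst_add, Prod.snd_add, Prod.fst_sub, Prod.snd_sub, Complex.ofReal_add,
      Complex.ofReal_sub]
    congr 2 <;> module
  have hsm : ∀ (t : ℝ) a, F (t • a) = t ^ 2 * F a := by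
    intro t a
    have : ((t • a).1 : ℂ) • x + ((t • a).2 : ℂ) • y =
        (t : ℂ) • ((a.1 : ℂ) • x + (a.2 : ℂ) • y) := by
      simp only [Prod.smul_fst, Prod.smul_snd, smul_eq_mul, Complex.ofReal_mul]
      module
    rw [hF]
    simp only [this, quadForm_smul]
    simp
  have h := add_eq_polarForm hpar (1, 0) (s • (0, 1))
  rw [polarForm_smul_right hpar (fun _ => hμ.quadForm_nonneg _) hsm, hsm] at h
  simpa [hF, polarForm, sub_eq_add_neg, -Complex.coe_smul] using h

theorem polarForm_add_polarForm_conj (hμ : IsQuantumMeasure μ) (hdim : 3 ≤ Module.rank ℂ H)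
    {x y : H} (hxy : ⟪x, y⟫_ℂ = 0) (hn : ‖x‖ = ‖y‖) {c : ℂ} (hc : ‖c‖ = 1) :
    polarForm (quadForm μ) x (c • y) + polarForm (quadForm μ) x ((starRingEnd ℂ) c • y) =
      2 * c.re * polarForm (quadForm μ) x y := by
  have hyx : ⟪y, x⟫_ℂ = 0 := inner_eq_zero_symm.mp hxy
  have hcc : c * (starRingEnd ℂ) c = 1 := by
    rw [Complex.mul_conj, Complex.normSq_eq_norm_sq, hc]; simp
  have key : ∀ c : ℂ, ‖c‖ = 1 → c * (starRingEnd ℂ) c = 1 →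
      ‖1 + c‖ ^ 2 * quadForm μ (x + y) + ‖1 - c‖ ^ 2 * quadForm μ (x - y) =
      2 * quadForm μ (x + c • y) + 2 * quadForm μ (x + (starRingEnd ℂ) c • y) := by
    intro c hc hcc
    have h := hμ.parallelogram_of_inner_real hdim (x := x + c • y) (y := c • x + y)
      (r := 2 * c.re * ‖y‖ ^ 2) (by
        simp only [inner_add_left, inner_add_right, inner_smul_left, inner_smul_right, hxy, hyx,
          inner_self_eq_norm_sq_to_K, hn]
        have := Complex.add_conj c
        push_cast at this ⊢
        simp only [Complex.coe_algebraMap]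
        linear_combination (‖y‖ : ℂ) ^ 2 * this)
    rw [show x + c • y + (c • x + y) = (1 + c) • (x + y) by module,
      show x + c • y - (c • x + y) = (1 - c) • (x - y) by module,
      show c • x + y = c • (x + (starRingEnd ℂ) c • y) by rw [smul_add, smul_smul, hcc, one_smul],
      quadForm_smul, quadForm_smul, quadForm_smul, hc] at h
    linarith
  have h1 := key c hc hcc
  have h2 := key (-c) (by simpa) (by simpa)
  have e1 : ‖1 + c‖ ^ 2 = 2 + 2 * c.re := by
    have hc2 : ‖c‖ ^ 2 = 1 := by rw [hc]; norm_num
    rw [← Complex.normSq_eq_norm_sq, Complex.normSq_apply] at hc2 ⊢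
    simp only [Complex.add_re, Complex.one_re, Complex.add_im, Complex.one_im]
    linarith
  have e2 : ‖1 - c‖ ^ 2 = 2 - 2 * c.re := by
    have hc2 : ‖c‖ ^ 2 = 1 := by rw [hc]; norm_num
    rw [← Complex.normSq_eq_norm_sq, Complex.normSq_apply] at hc2 ⊢
    simp only [Complex.sub_re, Complex.one_re, Complex.sub_im, Complex.one_im]
    linarith
  rw [sub_neg_eq_add, ← sub_eq_add_neg, _root_.map_neg, neg_smul, neg_smul, ← sub_eq_add_neg,
    ← sub_eq_add_neg] at h2
  rw [e1, e2] at h1 h2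
  simp only [polarForm]
  linarith

theorem polarForm_smul_unit (hμ : IsQuantumMeasure μ) (hdim : 3 ≤ Module.rank ℂ H)
    {x y : H} (hxy : ⟪x, y⟫_ℂ = 0) (hn : ‖x‖ = ‖y‖) {c : ℂ} (hc : ‖c‖ = 1) :
    polarForm (quadForm μ) x (c • y) = c.re * polarForm (quadForm μ) x y +
      c.im * polarForm (quadForm μ) x (Complex.I • y) := by
  have h1 := hμ.polarForm_add_polarForm_conj hdim hxy hn hc
  have h2 := hμ.polarForm_add_polarForm_conj hdim (y := Complex.I • y)
    (by rw [inner_smul_right, hxy, mul_zero]) (by rw [norm_smul]; simpa) (c := -Complex.I * c)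
    (by simpa)
  rw [smul_smul, smul_smul, show -Complex.I * c * Complex.I = c by
      linear_combination -c * Complex.I_mul_I,
    show (starRingEnd ℂ) (-Complex.I * c) * Complex.I = -(starRingEnd ℂ) c by
      simp only [_root_.map_mul, _root_.map_neg, Complex.conj_I]
      linear_combination (starRingEnd ℂ) c * Complex.I_mul_I, neg_smul, polarForm_neg_right] at h2
  simp only [neg_mul, Complex.neg_re, Complex.mul_re, Complex.I_re, Complex.I_im] at h2
  linarith

theorem quadForm_combination (hμ : IsQuantumMeasure μ) (hdim : 3 ≤ Module.rank ℂ H)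
    {x y : H} (hxy : ⟪x, y⟫_ℂ = 0) (hn : ‖x‖ = ‖y‖) (a b : ℂ) :
    quadForm μ (a • x + b • y) = ‖a‖ ^ 2 * quadForm μ x + ‖b‖ ^ 2 * quadForm μ y +
      2 * (((starRingEnd ℂ) a * b).re * polarForm (quadForm μ) x y +
        ((starRingEnd ℂ) a * b).im * polarForm (quadForm μ) x (Complex.I • y)) := by
  by_cases ha : a = 0
  · simp [ha, quadForm_smul]
  have key : ∀ t : ℂ, quadForm μ (x + t • y) = quadForm μ x + ‖t‖ ^ 2 * quadForm μ y +
      2 * (t.re * polarForm (quadForm μ) x y +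
        t.im * polarForm (quadForm μ) x (Complex.I • y)) := by
    intro t
    by_cases ht : t = 0
    · simp [ht]
    have hnt : ‖t‖ ≠ 0 := by simpa using ht
    have hu : ‖t / (‖t‖ : ℂ)‖ = 1 := by simp [hnt]
    have h := hμ.quadForm_real_combination hdim (y := (t / (‖t‖ : ℂ)) • y)
      (by rw [inner_smul_right, hxy, mul_zero]) ‖t‖
    rw [smul_smul, mul_div_cancel₀ _ (by exact_mod_cast hnt), quadForm_smul, hu,
      hμ.polarForm_smul_unit hdim hxy hn hu] at h
    rw [h, Complex.div_ofReal_re, Complex.div_ofReal_im]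
    field_simp
  have hab : a • x + b • y = a • (x + (b / a) • y) := by
    rw [smul_add, smul_smul, mul_div_cancel₀ _ ha]
  have hna : ‖a‖ ≠ 0 := by simpa using ha
  have hconj : (starRingEnd ℂ) a * b = ((‖a‖ ^ 2 : ℝ) : ℂ) * (b / a) := by
    rw [← Complex.normSq_eq_norm_sq, Complex.normSq_eq_conj_mul_self]
    field_simp
  rw [hab, quadForm_smul, key, hconj, Complex.re_ofReal_mul, Complex.im_ofReal_mul, norm_div]
  field_simp

/-- The quadratic extension of a measure on projections satisfies the parallelogram law. -/
theorem parallelogram (hμ : IsQuantumMeasure μ) (hdim : 3 ≤ Module.rank ℂ H) (x y : H) :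
    quadForm μ (x + y) + quadForm μ (x - y) = 2 * quadForm μ x + 2 * quadForm μ y := by
  obtain ⟨a, ha, -, hxa⟩ := exists_unit_direction hdim (inner_zero_left x : ⟪(0 : H), x⟫_ℂ = 0)
  have haa : ⟪a, a⟫_ℂ = 1 := by rw [inner_self_eq_norm_sq_to_K, ha]; simp
  have hz : ⟪a, y - ⟪a, y⟫_ℂ • a⟫_ℂ = 0 := by
    rw [inner_sub_right, inner_smul_right, haa, mul_one, sub_self]
  obtain ⟨b, hb, hab, hyb⟩ := exists_unit_direction hdim hz
  rw [sub_eq_iff_eq_add] at hyb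
  generalize (‖x‖ : ℂ) = α at hxa
  generalize (‖y - ⟪a, y⟫_ℂ • a‖ : ℂ) = β at hyb
  generalize ⟪a, y⟫_ℂ = γ at hyb
  have h := hμ.quadForm_combination hdim hab (ha.trans hb.symm)
  have h1 := h (α + γ) β
  have h2 := h (α - γ) (-β)
  have h3 := h α 0
  have h4 := h γ β
  rw [hyb, show x + (β • b + γ • a) = (α + γ) • a + β • b by rw [hxa]; module,
    show x - (β • b + γ • a) = (α - γ) • a + (-β) • b by rw [hxa]; module,
    show x = α • a + (0 : ℂ) • b by rw [hxa]; module, add_comm (β • b), h1, h2, h3, h4]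
  have hpar := parallelogram_law_with_norm ℝ α γ
  simp only [_root_.map_add, _root_.map_sub, Complex.add_re, Complex.sub_re, Complex.add_im,
    Complex.sub_im, Complex.mul_re, Complex.mul_im, Complex.conj_re, Complex.conj_im,
    Complex.neg_re, Complex.neg_im, Complex.zero_re, Complex.zero_im, norm_neg, norm_zero]
  linear_combination (quadForm μ a) * hpar

end IsQuantumMeasure

theorem exists_selfAdjoint_sq {T : H →L[ℂ] H} (hT : T.IsPositive) :
    ∃ S : H →L[ℂ] H, IsSelfAdjoint S ∧ S * S = T := by
  have hT' : 0 ≤ T := (ContinuousLinearMap.nonneg_iff_isPositive T).mpr hT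
  exact ⟨CFC.sqrt T, (CFC.sqrt_nonneg T).isSelfAdjoint, CFC.sqrt_mul_sqrt_self T⟩

theorem inner_apply_eq_of_isSelfAdjoint {S : H →L[ℂ] H} (hS : IsSelfAdjoint S) (x y : H) :
    ⟪S x, y⟫_ℂ = ⟪x, S y⟫_ℂ :=
  ContinuousLinearMap.isSelfAdjoint_iff_isSymmetric.mp hS x y

theorem polarForm_comm {F : H → ℝ} (hneg : ∀ x, F (-x) = F x) (x y : H) :
    polarForm F x y = polarForm F y x := by
  rw [polarForm, polarForm, add_comm, ← neg_sub y x, hneg]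

namespace IsQuantumMeasure

variable {μ : (H →L[ℂ] H) → ℝ}

theorem polarForm_smul_smul_of_norm_eq_one {c : ℂ} (hc : ‖c‖ = 1) (x y : H) :
    polarForm (quadForm μ) (c • x) (c • y) = polarForm (quadForm μ) x y := by
  rw [polarForm, polarForm, ← smul_add, ← smul_sub, quadForm_smul, quadForm_smul, hc]
  ring

theorem polarForm_I_smul_left (x y : H) : polarForm (quadForm μ) (Complex.I • x) y =
    -polarForm (quadForm μ) x (Complex.I • y) := by
  rw [← polarForm_smul_smul_of_norm_eq_one Complex.norm_I, smul_smul, Complex.I_mul_I, neg_one_smul,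
    polarForm_comm quadForm_neg, polarForm_neg_right, polarForm_comm quadForm_neg]

theorem abs_polarForm_le (hμ : IsQuantumMeasure μ) (hdim : 3 ≤ Module.rank ℂ H) (x y : H) :
    |polarForm (quadForm μ) x y| ≤ μ 1 * ‖x‖ * ‖y‖ := by
  have hsm : ∀ (t : ℝ) (x : H), quadForm μ (t • x) = t ^ 2 * quadForm μ x := by
    intro t x
    have := quadForm_smul (μ := μ) (t : ℂ) x
    simpa using this
  have hsmul := polarForm_smul_right (hμ.parallelogram hdim) hμ.quadForm_nonneg hsm
  by_cases hx : x = 0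
  · simp [hx, polarForm, quadForm_neg]
  by_cases hy : y = 0
  · simp [hy, polarForm]
  have hnx : 0 < ‖x‖ := norm_pos_iff.mpr hx
  have hny : 0 < ‖y‖ := norm_pos_iff.mpr hy
  have key : ∀ u v : H, ‖u‖ = 1 → ‖v‖ = 1 → |polarForm (quadForm μ) u v| ≤ μ 1 := by
    intro u v hu hv
    have h1 := hμ.quadForm_le u
    have h2 := hμ.quadForm_le v
    have h3 := hμ.quadForm_nonneg (u + v)
    have h4 := hμ.quadForm_nonneg (u - v)
    have h5 := hμ.parallelogram hdim u v
    have h6 := hμ.nonneg 1 isProjectionOp_one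
    rw [hu] at h1
    rw [hv] at h2
    rw [polarForm, abs_le]
    constructor <;> linarith
  have hk := key (‖x‖⁻¹ • x) (‖y‖⁻¹ • y) (norm_smul_inv_norm hx) (norm_smul_inv_norm hy)
  rw [hsmul, polarForm_comm quadForm_neg, hsmul, polarForm_comm quadForm_neg, abs_mul, abs_mul,
    abs_of_pos (inv_pos.mpr hny), abs_of_pos (inv_pos.mpr hnx)] at hk
  rw [inv_mul_le_iff₀ hny, inv_mul_le_iff₀ hnx] at hk
  linarith

/-- The sesquilinear form attached to a measure on projections. -/
noncomputable def sesqForm (hμ : IsQuantumMeasure μ) (hdim : 3 ≤ Module.rank ℂ H) :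
    H →ₗ⋆[ℂ] H →ₗ[ℂ] ℂ :=
  have hsm : ∀ (t : ℝ) (x : H), quadForm μ ((t : ℂ) • x) = t ^ 2 * quadForm μ x := by
    intro t x
    rw [quadForm_smul]
    simp
  have hpar := hμ.parallelogram hdim
  have hsmul : ∀ (t : ℝ) (x y : H),
      polarForm (quadForm μ) x ((t : ℂ) • y) = t * polarForm (quadForm μ) x y :=
    polarForm_smul_right hpar hμ.quadForm_nonneg hsm
  have hsmul_left : ∀ (t : ℝ) (x y : H),
      polarForm (quadForm μ) ((t : ℂ) • x) y = t * polarForm (quadForm μ) x y := by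
    intro t x y
    rw [polarForm_comm quadForm_neg, hsmul, polarForm_comm quadForm_neg]
  have hadd_left : ∀ x y z : H, polarForm (quadForm μ) (x + y) z =
      polarForm (quadForm μ) x z + polarForm (quadForm μ) y z := by
    intro x y z
    rw [polarForm_comm quadForm_neg, polarForm_add_right hpar, polarForm_comm quadForm_neg,
      polarForm_comm quadForm_neg z]
  have hdecomp : ∀ (c : ℂ) (x : H), c • x = (c.re : ℂ) • x + (c.im : ℂ) • Complex.I • x := by
    intro c x
    rw [smul_smul, ← add_smul, Complex.re_add_im]
  have hII : ∀ x : H, Complex.I • Complex.I • x = -x := fun x => by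
    rw [smul_smul, Complex.I_mul_I, neg_one_smul]
  LinearMap.mk₂'ₛₗ (starRingEnd ℂ) (RingHom.id ℂ)
    (fun x y => (polarForm (quadForm μ) x y : ℂ) -
      Complex.I * polarForm (quadForm μ) x (Complex.I • y))
    (by
      intro x x' y
      simp only [hadd_left]
      push_cast
      ring)
    (by
      intro c x y
      simp only [hdecomp c x, hadd_left, hsmul_left, polarForm_I_smul_left, hII,
        polarForm_neg_right, smul_eq_mul]
      apply Complex.ext <;> simp <;> ring)
    (by
      intro x y y'
      simp only [smul_add, polarForm_add_right hpar]
      push_cast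
      ring)
    (by
      intro c x y
      simp only [hdecomp c, smul_add, polarForm_add_right hpar, hsmul, smul_comm Complex.I (Complex.ofReal _), hII,
        polarForm_neg_right, smul_eq_mul]
      apply Complex.ext <;> simp <;> ring)

theorem sesqForm_apply (hμ : IsQuantumMeasure μ) (hdim : 3 ≤ Module.rank ℂ H) (x y : H) :
    hμ.sesqForm hdim x y = (polarForm (quadForm μ) x y : ℂ) -
      Complex.I * polarForm (quadForm μ) x (Complex.I • y) :=
  rfl

theorem sesqForm_self (hμ : IsQuantumMeasure μ) (hdim : 3 ≤ Module.rank ℂ H) (x : H) :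
    hμ.sesqForm hdim x x = quadForm μ x := by
  have h1 : polarForm (quadForm μ) x x = quadForm μ x := by
    have := quadForm_smul (μ := μ) 2 x
    rw [polarForm, sub_self, quadForm_zero, ← two_smul ℂ x, this]
    norm_num
  have h2 : polarForm (quadForm μ) x (Complex.I • x) = 0 := by
    have := polarForm_I_smul_left (μ := μ) x x
    rw [polarForm_comm quadForm_neg] at this
    linarith
  rw [sesqForm_apply, h1, h2]
  simp

theorem norm_sesqForm_le (hμ : IsQuantumMeasure μ) (hdim : 3 ≤ Module.rank ℂ H) (x y : H) :
    ‖hμ.sesqForm hdim x y‖ ≤ 2 * μ 1 * ‖x‖ * ‖y‖ := by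
  have h1 := hμ.abs_polarForm_le hdim x y
  have h2 := hμ.abs_polarForm_le hdim x (Complex.I • y)
  rw [norm_smul, Complex.norm_I, one_mul] at h2
  rw [sesqForm_apply]
  refine (norm_sub_le _ _).trans ?_
  rw [norm_mul, Complex.norm_I, one_mul, Complex.norm_real, Complex.norm_real, Real.norm_eq_abs,
    Real.norm_eq_abs]
  linarith

theorem exists_quadForm_eq_norm_sq (hμ : IsQuantumMeasure μ) (hdim : 3 ≤ Module.rank ℂ H) :
    ∃ S : H →L[ℂ] H, IsSelfAdjoint S ∧ ∀ x, quadForm μ x = ‖S x‖ ^ 2 := by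
  set T := InnerProductSpace.continuousLinearMapOfBilin
    ((hμ.sesqForm hdim).mkContinuous₂ (2 * μ 1) (hμ.norm_sesqForm_le hdim))
  have hT : ∀ x, ⟪T x, x⟫_ℂ = quadForm μ x := fun x => by
    rw [InnerProductSpace.continuousLinearMapOfBilin_apply, LinearMap.mkContinuous₂_apply,
      sesqForm_self]
  have hpos : T.IsPositive := by
    rw [ContinuousLinearMap.isPositive_iff_complex]
    intro x
    rw [hT]
    exact ⟨rfl, hμ.quadForm_nonneg x⟩
  obtain ⟨S, hS, hST⟩ := exists_selfAdjoint_sq hpos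
  refine ⟨S, hS, fun x => ?_⟩
  have h := congrArg Complex.re (hT x)
  rw [← hST, mul_apply_eq_comp, inner_apply_eq_of_isSelfAdjoint hS] at h
  rw [norm_sq_eq_re_inner (𝕜 := ℂ)]
  exact h.symm

end IsQuantumMeasure

theorem Orthonormal.countable_of_separableSpace {K : Type*} [NormedAddCommGroup K]
    [InnerProductSpace ℂ K] [TopologicalSpace.SeparableSpace K] {ι : Type*} {v : ι → K}
    (hv : Orthonormal ℂ v) : Countable ι := by
  refine Pairwise.countable_of_isOpen_disjoint (s := fun i => Metric.ball (v i) (1 / 2)) ?_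
    (fun i => Metric.isOpen_ball) (fun i => Metric.nonempty_ball.mpr (by norm_num))
  intro i j hij
  refine Metric.ball_disjoint_ball ?_
  have h : ‖v i - v j‖ ^ 2 = 2 := by
    rw [norm_sub_sq (𝕜 := ℂ), hv.1 i, hv.1 j, hv.2 hij]
    norm_num
  rw [dist_eq_norm]
  nlinarith [norm_nonneg (v i - v j)]

theorem exists_hilbertBasis_small (K : Type*) [NormedAddCommGroup K] [InnerProductSpace ℂ K]
    [CompleteSpace K] [TopologicalSpace.SeparableSpace K] :
    ∃ ι : Type, Nonempty (HilbertBasis ι ℂ K) := by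
  obtain ⟨w, b, -⟩ := exists_hilbertBasis ℂ K
  have := b.orthonormal.countable_of_separableSpace
  let f := equivShrink.{0} w
  refine ⟨Shrink.{0} w, ⟨HilbertBasis.mk (b.orthonormal.comp f.symm f.symm.injective) ?_⟩⟩
  rw [f.symm.surjective.range_comp]
  exact b.dense_span.ge

theorem IsProjectionOp.exists_orthonormal [TopologicalSpace.SeparableSpace H] {p : H →L[ℂ] H}
    (hp : IsProjectionOp p) : ∃ (ι : Type) (c : ι → H), Orthonormal ℂ c ∧
      ∀ v, HasSum (fun i => lineProj (c i) v) (p v) := by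
  obtain ⟨U, hU, rfl⟩ := isStarProjection_iff_eq_starProjection.mp
    (⟨hp.1, hp.2⟩ : IsStarProjection p)
  have : SecondCountableTopology H := UniformSpace.secondCountable_of_separable H
  have hclosed : IsClosed (U : Set H) := by
    rw [← U.orthogonal_orthogonal]
    exact Submodule.isClosed_orthogonal _
  have : CompleteSpace U := hclosed.completeSpace_coe
  obtain ⟨ι, ⟨b⟩⟩ := exists_hilbertBasis_small U
  have hb : Orthonormal ℂ fun i => (b i : H) := b.orthonormal.comp_linearIsometry U.subtypeₗᵢ
  refine ⟨ι, fun i => b i, hb, fun v => ?_⟩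
  have h := (b.hasSum_orthogonalProjectionOnto v).mapL U.subtypeL
  simpa [lineProj_apply, hb.1] using h

section Sums

variable {ι : Type*} {f : ι → ℝ} {a : ℝ}

theorem HasSum.tsum_ofReal_eq (hf : ∀ i, 0 ≤ f i) (h : HasSum f a) :
    ∑' i, ENNReal.ofReal (f i) = ENNReal.ofReal a := by
  rw [← h.tsum_eq, ENNReal.ofReal_tsum_of_nonneg hf h.summable]

theorem hasSum_of_tsum_ofReal_eq (hf : ∀ i, 0 ≤ f i) (ha : 0 ≤ a)
    (h : ∑' i, ENNReal.ofReal (f i) = ENNReal.ofReal a) : HasSum f a := by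
  have hs : ∑' i, ENNReal.ofReal (f i) ≠ ⊤ := h ▸ ENNReal.ofReal_ne_top
  have h' := ENNReal.hasSum_toReal hs
  rw [← ENNReal.tsum_toReal_eq (fun i => ENNReal.ofReal_ne_top), h, ENNReal.toReal_ofReal ha] at h'
  simpa only [ENNReal.toReal_ofReal (hf _)] using h'

end Sums

theorem IsProjectionOp.inner_apply_eq {p : H →L[ℂ] H} (hp : IsProjectionOp p) (v : H) :
    ⟪v, p v⟫_ℂ = ((‖p v‖ ^ 2 : ℝ) : ℂ) := by
  have h : p (p v) = p v := congrArg (fun q : H →L[ℂ] H => q v) hp.1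
  rw [← h, ← inner_apply_eq_of_isSelfAdjoint hp.2, h, inner_self_eq_norm_sq_to_K]
  push_cast
  rfl

theorem inner_lineProj (x v : H) :
    ⟪v, lineProj x v⟫_ℂ = ((‖⟪x, v⟫_ℂ‖ ^ 2 / ‖x‖ ^ 2 : ℝ) : ℂ) := by
  rw [lineProj_apply, inner_smul_right, div_mul_eq_mul_div, ← inner_conj_symm v x,
    Complex.mul_conj, Complex.normSq_eq_norm_sq]
  push_cast
  rfl

theorem hasSum_norm_inner_sq {ι : Type*} {c : ι → H} (hc : Orthonormal ℂ c) {p : H →L[ℂ] H}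
    (hp : IsProjectionOp p) {v : H} (h : HasSum (fun i => lineProj (c i) v) (p v)) :
    HasSum (fun i => ‖⟪c i, v⟫_ℂ‖ ^ 2) (‖p v‖ ^ 2) := by
  have h' := h.mapL (innerSL ℂ v)
  simp only [innerSL_apply_apply, hp.inner_apply_eq, inner_lineProj, hc.1, one_pow, div_one] at h'
  exact Complex.hasSum_ofReal.mp h'

theorem HilbertBasis.hasSum_norm_inner_sq {ι : Type*} (b : HilbertBasis ι ℂ H) (v : H) :
    HasSum (fun i => ‖⟪b i, v⟫_ℂ‖ ^ 2) (‖v‖ ^ 2) := by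
  refine _root_.hasSum_norm_inner_sq b.orthonormal isProjectionOp_one (p := 1) ?_
  have := b.hasSum_repr v
  simp only [b.repr_apply_apply] at this
  simpa [lineProj_apply, b.orthonormal.1] using this

/-- `Φ` is the functional `x ↦ ∑ ⟪vₙ, x vₙ⟫`. -/
def IsVectorFunctional {κ : Type*} (Φ : (H →L[ℂ] H) →L[ℂ] ℂ) (v : κ → H) : Prop :=
  ∀ x, HasSum (fun n => ⟪v n, x (v n)⟫_ℂ) (Φ x)

theorem exists_isVectorFunctional {κ : Type*} {v : κ → H} (hv : Summable fun n => ‖v n‖ ^ 2) :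
    ∃ Φ, IsVectorFunctional Φ v := by
  let φ : κ → (H →L[ℂ] H) →L[ℂ] ℂ :=
    fun n => (innerSL ℂ (v n)).comp (ContinuousLinearMap.apply ℂ H (v n))
  have hφ : Summable φ := by
    refine Summable.of_norm_bounded hv fun n => ?_
    refine ContinuousLinearMap.opNorm_le_bound _ (by positivity) fun x => ?_
    calc ‖⟪v n, x (v n)⟫_ℂ‖ ≤ ‖v n‖ * ‖x (v n)‖ := norm_inner_le_norm _ _
      _ ≤ ‖v n‖ * (‖x‖ * ‖v n‖) := by gcongr; exact x.le_opNorm _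
      _ = ‖v n‖ ^ 2 * ‖x‖ := by ring
  exact ⟨∑' n, φ n, fun x => hφ.hasSum.mapL (ContinuousLinearMap.apply ℂ ℂ x)⟩

namespace IsVectorFunctional

variable {κ : Type*} {Φ : (H →L[ℂ] H) →L[ℂ] ℂ} {v : κ → H}

theorem hasSum_re (h : IsVectorFunctional Φ v) {x : H →L[ℂ] H} {g : H → ℝ}
    (hg : ∀ w, ⟪w, x w⟫_ℂ = (g w : ℂ)) : HasSum (fun n => g (v n)) (Φ x).re := by
  have := Complex.hasSum_re (h x)
  simpa only [hg, Complex.ofReal_re] using this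

theorem im_eq_zero (h : IsVectorFunctional Φ v) {x : H →L[ℂ] H} {g : H → ℝ}
    (hg : ∀ w, ⟪w, x w⟫_ℂ = (g w : ℂ)) : (Φ x).im = 0 := by
  have := Complex.hasSum_im (h x)
  simp only [hg, Complex.ofReal_im] at this
  exact this.unique hasSum_zero

theorem hasSum_norm_sq (h : IsVectorFunctional Φ v) {S : H →L[ℂ] H} (hS : IsSelfAdjoint S) :
    HasSum (fun n => ‖S (v n)‖ ^ 2) (Φ (S * S)).re ∧ (Φ (S * S)).im = 0 := by
  have hg : ∀ w, ⟪w, (S * S) w⟫_ℂ = ((‖S w‖ ^ 2 : ℝ) : ℂ) := fun w => by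
    rw [mul_apply_eq_comp, ← inner_apply_eq_of_isSelfAdjoint hS, inner_self_eq_norm_sq_to_K]
    push_cast
    rfl
  exact ⟨h.hasSum_re hg, h.im_eq_zero hg⟩

theorem nonneg (h : IsVectorFunctional Φ v) {x : H →L[ℂ] H} (hx : x.IsPositive) :
    0 ≤ (Φ x).re ∧ (Φ x).im = 0 := by
  obtain ⟨S, hS, rfl⟩ := exists_selfAdjoint_sq hx
  have := h.hasSum_norm_sq hS
  exact ⟨this.1.nonneg fun n => sq_nonneg _, this.2⟩

theorem norm_le (h : IsVectorFunctional Φ v) : ‖Φ‖ ≤ (Φ 1).re := by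
  have h1 := (h.hasSum_norm_sq (S := 1) (IsSelfAdjoint.one _)).1
  rw [mul_one] at h1
  refine Φ.opNorm_le_bound (h1.nonneg fun n => sq_nonneg _) fun x => ?_
  rw [← (h x).tsum_eq]
  refine tsum_of_norm_bounded (h1.mul_right ‖x‖) fun n => ?_
  calc ‖⟪v n, x (v n)⟫_ℂ‖ ≤ ‖v n‖ * ‖x (v n)‖ := norm_inner_le_norm _ _
    _ ≤ ‖v n‖ * (‖x‖ * ‖v n‖) := by gcongr; exact x.le_opNorm _
    _ = ‖v n‖ ^ 2 * ‖x‖ := by ring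

theorem hasSum_norm_inner_sq (h : IsVectorFunctional Φ v) (z : H) :
    HasSum (fun n => ‖⟪z, v n⟫_ℂ‖ ^ 2) (‖z‖ ^ 2 * (Φ (lineProj z)).re) := by
  by_cases hz : z = 0
  · simp [hz, hasSum_zero]
  have hn : ‖z‖ ≠ 0 := by simpa using hz
  have := (h.hasSum_re (inner_lineProj z)).mul_left (‖z‖ ^ 2)
  simpa only [mul_div_cancel₀ _ (pow_ne_zero 2 hn)] using this

/-- The values of a vector functional on lines determine its values on positive operators. -/
theorem hasSum_lineProj (h : IsVectorFunctional Φ v) {ι : Type*} (b : HilbertBasis ι ℂ H)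
    {S : H →L[ℂ] H} (hS : IsSelfAdjoint S) :
    HasSum (fun j => ‖S (b j)‖ ^ 2 * (Φ (lineProj (S (b j)))).re) (Φ (S * S)).re := by
  have hSS := (h.hasSum_norm_sq hS).1
  refine hasSum_of_tsum_ofReal_eq
    (fun j => (h.hasSum_norm_inner_sq (S (b j))).nonneg fun n => sq_nonneg _)
    (hSS.nonneg fun n => sq_nonneg _) ?_
  calc ∑' j, ENNReal.ofReal (‖S (b j)‖ ^ 2 * (Φ (lineProj (S (b j)))).re)
      = ∑' j, ∑' n, ENNReal.ofReal (‖⟪S (b j), v n⟫_ℂ‖ ^ 2) := tsum_congr fun j =>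
        ((h.hasSum_norm_inner_sq (S (b j))).tsum_ofReal_eq fun n => sq_nonneg _).symm
    _ = ∑' n, ∑' j, ENNReal.ofReal (‖⟪b j, S (v n)⟫_ℂ‖ ^ 2) := by
        rw [ENNReal.tsum_comm]
        simp only [inner_apply_eq_of_isSelfAdjoint hS]
    _ = ∑' n, ENNReal.ofReal (‖S (v n)‖ ^ 2) := tsum_congr fun n =>
        (b.hasSum_norm_inner_sq (S (v n))).tsum_ofReal_eq fun j => sq_nonneg _
    _ = ENNReal.ofReal (Φ (S * S)).re := hSS.tsum_ofReal_eq fun n => sq_nonneg _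

end IsVectorFunctional

/-- Gleason's theorem. -/
theorem IsQuantumMeasure.exists_isVectorFunctional [TopologicalSpace.SeparableSpace H]
    {μ : (H →L[ℂ] H) → ℝ} (hμ : IsQuantumMeasure μ) (hdim : 3 ≤ Module.rank ℂ H) :
    ∃ (κ : Type) (v : κ → H) (Φ : (H →L[ℂ] H) →L[ℂ] ℂ), IsVectorFunctional Φ v ∧
      ∀ p, IsProjectionOp p → Φ p = μ p := by
  obtain ⟨S, hS, hSμ⟩ := hμ.exists_quadForm_eq_norm_sq hdim
  obtain ⟨κ, ⟨b⟩⟩ := exists_hilbertBasis_small H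
  have key : ∀ p, IsProjectionOp p → HasSum (fun n => ‖p (S (b n))‖ ^ 2) (μ p) := by
    intro p hp
    obtain ⟨ι, c, hc, hcp⟩ := hp.exists_orthonormal
    have hsum := hμ.hasSum ι (fun i => lineProj (c i)) p (fun i => isProjectionOp_lineProj _) hp
      (fun i j hij => lineProj_mul_lineProj (hc.2 hij)) hcp
    refine hasSum_of_tsum_ofReal_eq (fun n => sq_nonneg _) (hμ.nonneg p hp) ?_
    calc ∑' n, ENNReal.ofReal (‖p (S (b n))‖ ^ 2)
        = ∑' n, ∑' j, ENNReal.ofReal (‖⟪c j, S (b n)⟫_ℂ‖ ^ 2) := tsum_congr fun n =>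
          ((hasSum_norm_inner_sq hc hp (hcp _)).tsum_ofReal_eq fun j => sq_nonneg _).symm
      _ = ∑' j, ∑' n, ENNReal.ofReal (‖⟪b n, S (c j)⟫_ℂ‖ ^ 2) := by
          rw [ENNReal.tsum_comm]
          simp only [← inner_apply_eq_of_isSelfAdjoint hS, norm_inner_symm (S (c _))]
      _ = ∑' j, ENNReal.ofReal (‖S (c j)‖ ^ 2) := tsum_congr fun j =>
          (b.hasSum_norm_inner_sq (S (c j))).tsum_ofReal_eq fun n => sq_nonneg _
      _ = ∑' j, ENNReal.ofReal (μ (lineProj (c j))) := by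
          simp only [← hSμ, quadForm, hc.1, one_pow, one_mul]
      _ = ENNReal.ofReal (μ p) :=
          hsum.tsum_ofReal_eq fun j => hμ.nonneg _ (isProjectionOp_lineProj _)
  obtain ⟨Φ, hΦ⟩ := _root_.exists_isVectorFunctional (key 1 isProjectionOp_one).summable
  refine ⟨κ, _, Φ, hΦ, fun p hp => Complex.ext ?_ ?_⟩
  · exact (hΦ.hasSum_re hp.inner_apply_eq).unique (key p hp)
  · exact hΦ.im_eq_zero hp.inner_apply_eq

/-- The functionals whose values on positive operators are determined by their values on lines,
relative to a Hilbert basis. -/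
def normalFunctionals {ι : Type*} (b : HilbertBasis ι ℂ H) :
    Submodule ℂ ((H →L[ℂ] H) →L[ℂ] ℂ) where
  carrier := {L | ∀ S : H →L[ℂ] H, IsSelfAdjoint S →
    HasSum (fun j => ((‖S (b j)‖ ^ 2 : ℝ) : ℂ) * L (lineProj (S (b j)))) (L (S * S))}
  zero_mem' S _ := by simp [hasSum_zero]
  add_mem' hL hL' S hS := by
    simpa only [add_apply, mul_add] using (hL S hS).add (hL' S hS)
  smul_mem' c L hL S hS := by
    simpa only [smul_apply, smul_eq_mul, mul_left_comm] using
      (hL S hS).mul_left c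

theorem IsVectorFunctional.mem_normalFunctionals {κ ι : Type*} {Φ : (H →L[ℂ] H) →L[ℂ] ℂ}
    {v : κ → H} (h : IsVectorFunctional Φ v) (b : HilbertBasis ι ℂ H) :
    Φ ∈ normalFunctionals b := by
  intro S hS
  have hr : ∀ x : H →L[ℂ] H, (Φ x).im = 0 → Φ x = ((Φ x).re : ℂ) := fun x hx =>
    Complex.ext rfl (by simpa using hx)
  rw [hr _ (h.hasSum_norm_sq hS).2]
  have := Complex.hasSum_ofReal.mpr (h.hasSum_lineProj b hS)
  simp only [Complex.ofReal_mul] at this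
  simpa only [← hr _ (h.im_eq_zero (inner_lineProj _))] using this

theorem eq_zero_of_mem_normalFunctionals {ι : Type*} {b : HilbertBasis ι ℂ H}
    {L : (H →L[ℂ] H) →L[ℂ] ℂ} (hL : L ∈ normalFunctionals b)
    (h0 : ∀ e, IsProjectionOp e → L e = 0) : L = 0 := by
  have hpos : ∀ x : H →L[ℂ] H, 0 ≤ x → L x = 0 := by
    intro x hx
    obtain ⟨S, hS, rfl⟩ :=
      exists_selfAdjoint_sq ((ContinuousLinearMap.nonneg_iff_isPositive x).mp hx)
    have := hL S hS
    simp only [h0 _ (isProjectionOp_lineProj _), mul_zero] at this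
    exact this.unique hasSum_zero
  ext x
  obtain ⟨y, hy, -, rfl⟩ := CStarAlgebra.exists_sum_four_nonneg x
  simp [hpos _ (hy _)]

theorem eq_of_mem_normalFunctionals {ι : Type*} {b : HilbertBasis ι ℂ H}
    {L L' : (H →L[ℂ] H) →L[ℂ] ℂ} (hL : L ∈ normalFunctionals b) (hL' : L' ∈ normalFunctionals b)
    (h : ∀ e, IsProjectionOp e → L e = L' e) : L = L' :=
  sub_eq_zero.mp <| eq_zero_of_mem_normalFunctionals (sub_mem hL hL') fun e he => by
    rw [sub_apply, h e he, sub_self]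

end Gleason

/-- If `Φ e` extends `m · e` to a vector functional for every projection `e`, then the values of
`Φ` at a positive operator form a measure on projections. -/
theorem IsQuantumBimeasure.isQuantumMeasure_re [TopologicalSpace.SeparableSpace H₁]
    {m : (H₁ →L[ℂ] H₁) → (H₂ →L[ℂ] H₂) → ℝ} (hm : IsQuantumBimeasure m)
    {Φ : (H₂ →L[ℂ] H₂) → (H₁ →L[ℂ] H₁) →L[ℂ] ℂ} {κ : (H₂ →L[ℂ] H₂) → Type}
    {v : ∀ e, κ e → H₁} (hΦ : ∀ e, IsProjectionOp e → IsVectorFunctional (Φ e) (v e))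
    (hΦm : ∀ e, IsProjectionOp e → ∀ p, IsProjectionOp p → Φ e p = m p e)
    {x : H₁ →L[ℂ] H₁} (hx : x.IsPositive) : IsQuantumMeasure fun e => (Φ e x).re where
  nonneg e he := ((hΦ e he).nonneg hx).1
  hasSum ι p q hp hq horth hsum := by
    refine hasSum_of_tsum_ofReal_eq (fun i => ((hΦ _ (hp i)).nonneg hx).1)
      ((hΦ q hq).nonneg hx).1 ?_
    obtain ⟨S, hS, rfl⟩ := exists_selfAdjoint_sq hx
    obtain ⟨τ, ⟨b⟩⟩ := exists_hilbertBasis_small H₁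
    have hnn : ∀ e, IsProjectionOp e → ∀ j, 0 ≤ ‖S (b j)‖ ^ 2 * m (lineProj (S (b j))) e :=
      fun e he j => mul_nonneg (sq_nonneg _) (hm.1 _ _ (isProjectionOp_lineProj _) he)
    have hE : ∀ e, IsProjectionOp e → ENNReal.ofReal (Φ e (S * S)).re =
        ∑' j, ENNReal.ofReal (‖S (b j)‖ ^ 2 * m (lineProj (S (b j))) e) := by
      intro e he
      have h := (hΦ e he).hasSum_lineProj b hS
      simp only [hΦm e he _ (isProjectionOp_lineProj _), Complex.ofReal_re] at h
      exact (h.tsum_ofReal_eq (hnn e he)).symm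
    calc ∑' i, ENNReal.ofReal (Φ (p i) (S * S)).re
        = ∑' i, ∑' j, ENNReal.ofReal (‖S (b j)‖ ^ 2 * m (lineProj (S (b j))) (p i)) :=
          tsum_congr fun i => hE _ (hp i)
      _ = ∑' j, ENNReal.ofReal (‖S (b j)‖ ^ 2 * m (lineProj (S (b j))) q) := by
          rw [ENNReal.tsum_comm]
          refine tsum_congr fun j => HasSum.tsum_ofReal_eq (fun i => hnn _ (hp i) j) ?_
          exact (hm.2.2 ι p q _ (isProjectionOp_lineProj _) hp hq horth hsum).mul_left _
      _ = ENNReal.ofReal (Φ q (S * S)).re := (hE q hq).symm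

/-- For a positive, completely additive quantum bi-measure `m` on separable
Hilbert spaces of dimension at least 3, the bounded bilinear extension `M`
of `m` is, in each fixed positive first argument, a positive normal
(i.e. completely additive) functional on `B(H₂)`. -/
theorem bimeasure_extension_positive_normal
    [TopologicalSpace.SeparableSpace H₁] [TopologicalSpace.SeparableSpace H₂]
    (hdim₁ : 3 ≤ Module.rank ℂ H₁) (hdim₂ : 3 ≤ Module.rank ℂ H₂)
    (m : (H₁ →L[ℂ] H₁) → (H₂ →L[ℂ] H₂) → ℝ) (hm : IsQuantumBimeasure m) :
    ∃ M : (H₁ →L[ℂ] H₁) →L[ℂ] (H₂ →L[ℂ] H₂) →L[ℂ] ℂ,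
      -- `M` extends `m`
      (∀ e₁ e₂, IsProjectionOp e₁ → IsProjectionOp e₂ →
        M e₁ e₂ = (m e₁ e₂ : ℂ)) ∧
      -- for each positive `x₁`, `y ↦ M x₁ y` is a positive normal functional
      ∀ x₁ : H₁ →L[ℂ] H₁, x₁.IsPositive →
        -- positivity
        ((∀ y : H₂ →L[ℂ] H₂, y.IsPositive →
            0 ≤ (M x₁ y).re ∧ (M x₁ y).im = 0) ∧
        -- normality: complete additivity on orthogonal families of
        -- projections summed in the strong operator topology
        (∀ (ι : Type) (p : ι → (H₂ →L[ℂ] H₂)) (q : H₂ →L[ℂ] H₂),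
          (∀ i, IsProjectionOp (p i)) → IsProjectionOp q →
          (∀ i j, i ≠ j → p i * p j = 0) →
          (∀ v : H₂, HasSum (fun i => p i v) (q v)) →
          HasSum (fun i => M x₁ (p i)) (M x₁ q))) := by
  classical
  have hfirst : ∀ e : H₂ →L[ℂ] H₂, ∃ (κ : Type) (v : κ → H₁) (Φ : (H₁ →L[ℂ] H₁) →L[ℂ] ℂ),
      IsProjectionOp e → IsVectorFunctional Φ v ∧ ∀ p, IsProjectionOp p → Φ p = m p e := by
    intro e
    by_cases he : IsProjectionOp e
    · have hμ : IsQuantumMeasure fun p => m p e :=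
        ⟨fun p hp => hm.1 p e hp he, fun ι p q => hm.2.1 ι p q e he⟩
      obtain ⟨κ, v, Φ, h⟩ := hμ.exists_isVectorFunctional hdim₁
      exact ⟨κ, v, Φ, fun _ => h⟩
    · exact ⟨Empty, Empty.elim, 0, fun h => absurd h he⟩
  choose κ v Φ hΦ using hfirst
  have hpos : ∀ x : H₁ →L[ℂ] H₁, x.IsPositive → IsQuantumMeasure fun e => (Φ e x).re := fun x hx =>
    hm.isQuantumMeasure_re (fun e he => (hΦ e he).1) (fun e he => (hΦ e he).2) hx
  have hre : ∀ x : H₁ →L[ℂ] H₁, x.IsPositive → ∀ e, IsProjectionOp e →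
      ((Φ e x).re : ℂ) = Φ e x := fun x hx e he =>
    Complex.ext rfl (by simpa using ((hΦ e he).1.nonneg hx).2.symm)
  obtain ⟨τ, ⟨b⟩⟩ := exists_hilbertBasis_small H₂
  have hvec : ∀ x : H₁ →L[ℂ] H₁, x.IsPositive → ∃ (σ : Type) (u : σ → H₂)
      (Ψ : (H₂ →L[ℂ] H₂) →L[ℂ] ℂ), IsVectorFunctional Ψ u ∧
        ∀ e, IsProjectionOp e → Ψ e = Φ e x := by
    intro x hx
    obtain ⟨σ, u, Ψ, hΨ, hΨe⟩ := (hpos x hx).exists_isVectorFunctional hdim₂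
    exact ⟨σ, u, Ψ, hΨ, fun e he => by rw [hΨe e he, hre x hx e he]⟩
  have hex : ∀ x : H₁ →L[ℂ] H₁, ∃ L ∈ normalFunctionals b,
      (∀ e, IsProjectionOp e → L e = Φ e x) ∧ ‖L‖ ≤ 4 * ‖Φ 1‖ * ‖x‖ := by
    intro x
    obtain ⟨y, hy, hyx, hsum⟩ := CStarAlgebra.exists_sum_four_nonneg x
    choose σ u Ψ hΨ hΨe using fun i =>
      hvec (y i) ((ContinuousLinearMap.nonneg_iff_isPositive _).mp (hy i))
    refine ⟨∑ i : Fin 4, Complex.I ^ (i : ℕ) • Ψ i,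
      sum_mem fun i _ => Submodule.smul_mem _ _ ((hΨ i).mem_normalFunctionals b), ?_, ?_⟩
    · intro e he
      rw [hsum]
      simp [hΨe _ e he]
    · have hle : ∀ i, ‖Ψ i‖ ≤ ‖Φ 1‖ * ‖x‖ := fun i => calc
        ‖Ψ i‖ ≤ (Ψ i 1).re := (hΨ i).norm_le
        _ = (Φ 1 (y i)).re := by rw [hΨe i 1 isProjectionOp_one]
        _ ≤ ‖Φ 1 (y i)‖ := Complex.re_le_norm _
        _ ≤ ‖Φ 1‖ * ‖y i‖ := (Φ 1).le_opNorm _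
        _ ≤ ‖Φ 1‖ * ‖x‖ := by gcongr; exact hyx i
      calc ‖∑ i : Fin 4, Complex.I ^ (i : ℕ) • Ψ i‖
          ≤ ∑ i : Fin 4, ‖Complex.I ^ (i : ℕ) • Ψ i‖ := norm_sum_le _ _
        _ ≤ ∑ _i : Fin 4, ‖Φ 1‖ * ‖x‖ := Finset.sum_le_sum fun i _ => by
            simpa [norm_smul] using hle i
        _ = 4 * ‖Φ 1‖ * ‖x‖ := by simp [mul_assoc]
  choose L hLmem hLe hLnorm using hex
  let M : (H₁ →L[ℂ] H₁) →L[ℂ] (H₂ →L[ℂ] H₂) →L[ℂ] ℂ := LinearMap.mkContinuous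
    { toFun := L
      map_add' := fun x y => eq_of_mem_normalFunctionals (hLmem _)
        (add_mem (hLmem x) (hLmem y)) fun e he => by simp [hLe _ e he]
      map_smul' := fun c x => eq_of_mem_normalFunctionals (hLmem _)
        (Submodule.smul_mem _ c (hLmem x)) fun e he => by simp [hLe _ e he] }
    (4 * ‖Φ 1‖) hLnorm
  have hM : ∀ x, M x = L x := fun x => rfl
  refine ⟨M, fun e₁ e₂ h₁ h₂ => ?_, fun x hx => ⟨fun y hy => ?_, fun ι p q hp hq horth hsum => ?_⟩⟩
  · rw [hM, hLe e₁ e₂ h₂, (hΦ e₂ h₂).2 e₁ h₁]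
  · obtain ⟨σ, u, Ψ, hΨ, hΨe⟩ := hvec x hx
    rw [hM, eq_of_mem_normalFunctionals (hLmem x) (hΨ.mem_normalFunctionals b)
      fun e he => (hLe x e he).trans (hΨe e he).symm]
    exact hΨ.nonneg hy
  · have h := Complex.hasSum_ofReal.mpr ((hpos x hx).hasSum ι p q hp hq horth hsum)
    simpa only [hM, hLe x q hq, hLe x _ (hp _), hre x hx q hq, hre x hx _ (hp _)] using h
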